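/- Assume Schanuel's Conjecture. Let n ≥ 1 and let V ⊆ ℂ^n × (ℂ*)^n be an irreducible algebraic variety defined over the algebraic closure of ℚ with dim V = n. Assume that the projection π₁ of V to the first n coordinates and the projection π₂ of V to the last n coordinates are both dominant (i.e. π₁(V) is Zariski dense in ℂ^n and π₂(V) is Zariski dense in (ℂ*)^n). Then there exists ā = (a₁,…,aₙ) ∈ ℂ^n such that (ā, e^{ā}) = (a₁,…,aₙ, e^{a₁},…,e^{aₙ}) ∈ V and the transcendence degree of ℚ(a₁,…,aₙ, e^{a₁},…,e^{aₙ}) over ℚ equals n. -/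

import Mathlib

open MvPolynomial Complex

/-- The common zero set in `ℂ^σ` of a family of polynomials. -/
def zeroSet {σ : Type} (T : Set (MvPolynomial σ ℂ)) : Set (σ → ℂ) :=
  {x | ∀ p ∈ T, eval x p = 0}

/-- A subset of `ℂ^σ` is Zariski closed if it is the common zero set of a
family of polynomials. -/
def IsZClosed {σ : Type} (s : Set (σ → ℂ)) : Prop :=
  ∃ T : Set (MvPolynomial σ ℂ), s = zeroSet T

/-- The Zariski closure of a subset of `ℂ^σ`. -/
def zClosure {σ : Type} (s : Set (σ → ℂ)) : Set (σ → ℂ) :=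
  ⋂₀ {c : Set (σ → ℂ) | IsZClosed c ∧ s ⊆ c}

/-- A subset of `ℂ^σ` is Zariski dense if the only polynomial vanishing
identically on it is the zero polynomial. -/
def IsZDense {σ : Type} (s : Set (σ → ℂ)) : Prop :=
  ∀ p : MvPolynomial σ ℂ, (∀ x ∈ s, eval x p = 0) → p = 0

/-- A subset of `ℂ^σ` is irreducible (for the Zariski topology). -/
def IsZIrreducible {σ : Type} (s : Set (σ → ℂ)) : Prop :=
  s.Nonempty ∧ ∀ c₁ c₂ : Set (σ → ℂ), IsZClosed c₁ → IsZClosed c₂ →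
    s ⊆ c₁ ∪ c₂ → s ⊆ c₁ ∨ s ⊆ c₂

/-- The dimension of a subset of `ℂ^σ`: the Krull dimension of its Zariski
closure, i.e. the Krull dimension of the poset of irreducible Zariski closed
subsets of the closure (`⊥ = -1` for the empty set). -/
noncomputable def zdim {σ : Type} (s : Set (σ → ℂ)) : WithBot ℕ∞ :=
  Order.krullDim {t : Set (σ → ℂ) // IsZClosed t ∧ IsZIrreducible t ∧ t ⊆ zClosure s}

/-- Constructible subsets of `ℂ^σ`: finite Boolean combinations of Zariski
closed sets. -/
inductive IsZConstructible {σ : Type} : Set (σ → ℂ) → Prop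
  | of_closed (s : Set (σ → ℂ)) : IsZClosed s → IsZConstructible s
  | compl (s : Set (σ → ℂ)) : IsZConstructible s → IsZConstructible sᶜ
  | union (s t : Set (σ → ℂ)) : IsZConstructible s → IsZConstructible t →
      IsZConstructible (s ∪ t)

/-- "The transcendence degree of `K(s)` over `K` is at least `r`":
there are `r` elements of `s` that are algebraically independent over `K`. -/
def TrdegGe (K : Type) [Field K] [Algebra K ℂ] (s : Set ℂ) (r : ℕ) : Prop :=
  ∃ t : Finset ℂ, ↑t ⊆ s ∧ t.card = r ∧
    AlgebraicIndependent K (Subtype.val : ↥(t : Set ℂ) → ℂ)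

/-- "The transcendence degree of `K(s)` over `K` equals `m`": there is a
transcendence basis of `K(s)` over `K` consisting of `m` elements of `s`. -/
def TrdegEq (K : Type) [Field K] [Algebra K ℂ] (s : Set ℂ) (m : ℕ) : Prop :=
  ∃ t : Finset ℂ, ↑t ⊆ s ∧ t.card = m ∧
    AlgebraicIndependent K (Subtype.val : ↥(t : Set ℂ) → ℂ) ∧
    ∀ x ∈ s, IsAlgebraic (↥(IntermediateField.adjoin K (t : Set ℂ))) x

/-- Schanuel's Conjecture: the transcendence degree over `ℚ` of
`ℚ(z₁,…,zₙ,e^{z₁},…,e^{zₙ})` is at least the dimension of the `ℚ`-vector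
space spanned by `z₁,…,zₙ`. -/
def SchanuelConjecture : Prop :=
  ∀ (n : ℕ) (z : Fin n → ℂ),
    TrdegGe ℚ (Set.range z ∪ Set.range fun i => exp (z i))
      (Module.finrank ℚ ↥(Submodule.span ℚ (Set.range z)))

theorem MvPolynomial.IsHomogeneous.eval_smul {σ : Type*} {p : MvPolynomial σ ℂ} {d : ℕ}
    (hp : p.IsHomogeneous d) (c : ℂ) (a : σ → ℂ) :
    eval (c • a) p = c ^ d * eval a p := by
  rw [eval_eq, eval_eq, Finset.mul_sum]
  refine Finset.sum_congr rfl fun m hm => ?_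
  have hd : ∑ i ∈ m.support, m i = d := by
    have := hp (mem_support_iff.1 hm)
    simpa [Finsupp.weight_apply, Finsupp.sum] using this
  simp only [Pi.smul_apply, smul_eq_mul, mul_pow, Finset.prod_mul_distrib]
  rw [Finset.prod_pow_eq_pow_sum, hd]
  ring

theorem exists_int_eval_ne_zero {n : ℕ} {D : MvPolynomial (Fin n) ℂ} (hD : D ≠ 0) :
    ∃ q : Fin n → ℤ, eval (fun i => 2 * Real.pi * I * (q i : ℂ)) D ≠ 0 := by
  by_contra! h
  refine hD (funext_set (fun _ => Set.range fun m : ℤ => 2 * Real.pi * I * (m : ℂ))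
    (fun _ => Set.infinite_range_of_injective fun a b hab => ?_) fun x hx => ?_)
  · simpa [Real.pi_ne_zero] using hab
  · choose q hq using fun i => hx i (Set.mem_univ i)
    rw [map_zero, ← h q]
    congr 2
    exact funext fun i => (hq i).symm

/-- Away from a proper cone, a nonzero polynomial is bounded below near the points
`2πiNq` for a suitable integer vector `q`, uniformly in a ball of radius comparable to `N`. -/
theorem exists_norm_eval_lower_bound {n : ℕ} {δ : MvPolynomial (Fin n) ℂ} (hδ : δ ≠ 0) :
    ∃ q : Fin n → ℤ, ∃ ε > 0, ∃ c > 0, ∃ N₀ : ℝ, ∀ N : ℕ, N₀ ≤ N →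
      ∀ w ∈ Metric.ball (fun i => 2 * Real.pi * I * (q i : ℂ)) ε,
        c ≤ ‖eval ((N : ℂ) • w) δ‖ := by
  set d := δ.totalDegree
  have hD : homogeneousComponent d δ ≠ 0 := by
    obtain ⟨m, hm, hmd⟩ := Finset.exists_mem_eq_sup δ.support (support_nonempty.2 hδ)
      (fun s => s.sum fun _ e => e)
    intro h
    have := congrArg (coeff m) h
    rw [coeff_homogeneousComponent, if_pos, coeff_zero] at this
    · exact (mem_support_iff.1 hm) this
    · exact hmd.symm
  obtain ⟨q, hq⟩ := exists_int_eval_ne_zero hD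
  set v : Fin n → ℂ := fun i => 2 * Real.pi * I * (q i : ℂ)
  let H : ℂ × (Fin n → ℂ) → ℂ := fun z =>
    ∑ j ∈ Finset.range (d + 1), z.1 ^ (d - j) * eval z.2 (homogeneousComponent j δ)
  have hHc : Continuous H := by
    refine continuous_finsetSum _ fun j _ => ?_
    exact (continuous_fst.pow _).mul ((MvPolynomial.continuous_eval _).comp continuous_snd)
  have hH0 : H (0, v) = eval v (homogeneousComponent d δ) := by
    simp only [H]
    rw [Finset.sum_range_succ, Finset.sum_eq_zero]
    · simp
    · intro j hj
      have : d - j ≠ 0 := by have := Finset.mem_range.1 hj; omega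
      simp [this]
  have hpos : 0 < ‖H (0, v)‖ := by rw [hH0]; exact norm_pos_iff.2 hq
  have hev : ∀ᶠ z in nhds ((0 : ℂ), v), ‖H (0, v)‖ / 2 < ‖H z‖ :=
    hHc.norm.continuousAt.eventually (lt_mem_nhds (half_lt_self hpos))
  obtain ⟨ε, hε, hball⟩ := Metric.eventually_nhds_iff.1 hev
  refine ⟨q, ε, hε, _, half_pos hpos, max 1 (2 / ε), fun N hN w hw => ?_⟩
  have hN1 : (1 : ℝ) ≤ N := (le_max_left _ _).trans hN
  have hN0 : (N : ℂ) ≠ 0 := by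
    rintro h
    have : (N : ℝ) = 0 := by exact_mod_cast h
    linarith
  have hz : dist (((N : ℂ)⁻¹, w) : ℂ × (Fin n → ℂ)) (0, v) < ε := by
    rw [Prod.dist_eq, max_lt_iff]
    refine ⟨?_, hw⟩
    rw [dist_zero_right, norm_inv, Complex.norm_natCast]
    have h2 : 2 / ε ≤ N := (le_max_right _ _).trans hN
    rw [div_le_iff₀ hε] at h2
    rw [inv_lt_iff_one_lt_mul₀ (by linarith)]
    linarith
  have key : eval ((N : ℂ) • w) δ = (N : ℂ) ^ d * H ((N : ℂ)⁻¹, w) := by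
    conv_lhs => rw [← sum_homogeneousComponent δ]
    rw [map_sum, Finset.mul_sum]
    refine Finset.sum_congr rfl fun j hj => ?_
    rw [(homogeneousComponent_isHomogeneous j δ).eval_smul, ← mul_assoc]
    congr 1
    have hj' : j ≤ d := by have := Finset.mem_range.1 hj; omega
    conv_rhs => rw [← Nat.sub_add_cancel hj', pow_add]
    rw [mul_right_comm, Nat.sub_add_cancel hj', ← mul_pow, mul_inv_cancel₀ hN0, one_pow, one_mul]
  rw [key, norm_mul, norm_pow, Complex.norm_natCast]
  have := one_le_pow₀ (n := d) hN1
  have h3 := (hball hz).le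
  nlinarith [norm_nonneg (H ((N : ℂ)⁻¹, w))]

/-- A function on a family of points `a : E → ℂⁿ` is polynomially bounded. -/
def PolyBdd {E : Type*} {n : ℕ} (a : E → Fin n → ℂ) (g : E → ℂ) : Prop :=
  ∃ C : ℝ, 0 ≤ C ∧ ∃ m : ℕ, ∀ e, ‖g e‖ ≤ C * (1 + ‖a e‖) ^ m

namespace PolyBdd

variable {E : Type*} {n : ℕ} {a : E → Fin n → ℂ} {f g : E → ℂ}

theorem const (c : ℂ) : PolyBdd a fun _ => c := ⟨‖c‖, norm_nonneg _, 0, by simp⟩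

theorem mul (hf : PolyBdd a f) (hg : PolyBdd a g) : PolyBdd a fun e => f e * g e := by
  obtain ⟨C, hC, m, h⟩ := hf
  obtain ⟨C', hC', m', h'⟩ := hg
  refine ⟨C * C', mul_nonneg hC hC', m + m', fun e => ?_⟩
  rw [norm_mul, pow_add, mul_mul_mul_comm]
  exact mul_le_mul (h e) (h' e) (norm_nonneg _) (by positivity)

theorem add (hf : PolyBdd a f) (hg : PolyBdd a g) : PolyBdd a fun e => f e + g e := by
  obtain ⟨C, hC, m, h⟩ := hf
  obtain ⟨C', hC', m', h'⟩ := hg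
  refine ⟨C + C', add_nonneg hC hC', m + m', fun e => (norm_add_le _ _).trans ?_⟩
  have h1 : (1 : ℝ) ≤ 1 + ‖a e‖ := by linarith [norm_nonneg (a e)]
  rw [add_mul]
  refine add_le_add ((h e).trans ?_) ((h' e).trans ?_)
  · exact mul_le_mul_of_nonneg_left (pow_le_pow_right₀ h1 (by omega)) hC
  · exact mul_le_mul_of_nonneg_left (pow_le_pow_right₀ h1 (by omega)) hC'

theorem coord (i : Fin n) : PolyBdd a fun e => a e i :=
  ⟨1, zero_le_one, 1, fun e => by linarith [norm_le_pi_norm (a e) i]⟩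

theorem mvPolynomial (p : MvPolynomial (Fin n) ℂ) : PolyBdd a fun e => eval (a e) p := by
  induction p using MvPolynomial.induction_on with
  | C c => simpa using const c
  | add p q hp hq => simpa using hp.add hq
  | mul_X p i hp => simpa using hp.mul (coord i)

theorem polynomial (F : Polynomial (MvPolynomial (Fin n) ℂ)) (hg : PolyBdd a g) :
    PolyBdd a fun e => (F.map (eval (a e))).eval (g e) := by
  induction F using Polynomial.induction_on with
  | C c => simpa using mvPolynomial c
  | add p q hp hq => simpa using hp.add hq
  | monomial k c h =>
    have := h.mul hg
    simpa [pow_succ, mul_assoc] using this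

theorem of_root {P : Polynomial (MvPolynomial (Fin n) ℂ)} (hP : P.Monic)
    (hg : ∀ e, (P.map (eval (a e))).eval (g e) = 0) : PolyBdd a g := by
  have hsum : PolyBdd a fun e => ∑ j ∈ Finset.range P.natDegree,
      ((‖eval (a e) (P.coeff j)‖ : ℝ) : ℂ) := by
    have hn : ∀ p : MvPolynomial (Fin n) ℂ, PolyBdd a fun e => ((‖eval (a e) p‖ : ℝ) : ℂ) := by
      intro p
      obtain ⟨C, hC, m, h⟩ := mvPolynomial (a := a) p
      exact ⟨C, hC, m, by simpa using h⟩
    induction Finset.range P.natDegree using Finset.induction_on with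
    | empty => simpa using const 0
    | insert j s hj ih => simpa [Finset.sum_insert hj] using (hn _).add ih
  obtain ⟨C, hC, m, h⟩ := (const (a := a) 1).add hsum
  refine ⟨C, hC, m, fun e => le_trans ?_ (h e)⟩
  set S := ∑ j ∈ Finset.range P.natDegree, ‖eval (a e) (P.coeff j)‖
  have hS : 0 ≤ S := Finset.sum_nonneg fun _ _ => norm_nonneg _
  have hnorm : ‖(1 : ℂ) + ∑ j ∈ Finset.range P.natDegree,
      ((‖eval (a e) (P.coeff j)‖ : ℝ) : ℂ)‖ = 1 + S := by
    rw [← Complex.ofReal_sum, ← Complex.ofReal_one, ← Complex.ofReal_add, Complex.norm_real,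
      Real.norm_of_nonneg (by positivity)]
  rw [hnorm]
  by_contra! hlt
  set t := g e
  have ht1 : 1 < ‖t‖ := by linarith
  have hroot := hg e
  rw [Polynomial.eval_map, Polynomial.eval₂_eq_sum_range, Finset.sum_range_succ,
    hP.coeff_natDegree, map_one, one_mul, add_comm] at hroot
  have hle : ‖t‖ ^ P.natDegree ≤ S * ‖t‖ ^ (P.natDegree - 1) := by
    rw [← norm_pow, eq_neg_of_add_eq_zero_left hroot, norm_neg, Finset.sum_mul]
    refine (norm_sum_le _ _).trans (Finset.sum_le_sum fun j hj => ?_)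
    rw [norm_mul, norm_pow]
    refine mul_le_mul_of_nonneg_left (pow_le_pow_right₀ ht1.le ?_) (norm_nonneg _)
    have := Finset.mem_range.1 hj
    omega
  rcases Nat.eq_zero_or_pos P.natDegree with h0 | h0
  · rw [h0] at hroot
    simp at hroot
  · obtain ⟨k, hk⟩ := Nat.exists_eq_add_of_lt h0
    rw [hk, zero_add, pow_succ, Nat.add_sub_cancel] at hle
    have hpos : 0 < ‖t‖ ^ k := by positivity
    nlinarith

end PolyBdd

theorem exists_hasStrictFDerivAt_fst_prod {X : Type*} [NormedAddCommGroup X] [NormedSpace ℂ X]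
    [CompleteSpace X]
    {G : X × ℂ → ℂ} {e : X × ℂ} {c : ℂ} {G' : X × ℂ →L[ℂ] ℂ} (hG : HasStrictFDerivAt G G' e)
    (hc : HasDerivAt (fun t => G (e.1, t)) c e.2) (h0 : c ≠ 0) :
    ∃ Φ : (X × ℂ) ≃L[ℂ] (X × ℂ),
      HasStrictFDerivAt (fun z : X × ℂ => (z.1, G z)) (Φ : X × ℂ →L[ℂ] X × ℂ) e := by
  have hG'c : ∀ s : ℂ, G' (0, s) = s * c := by
    have h1 : HasDerivAt (fun t => G (e.1, t)) (G' (0, 1)) e.2 :=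
      HasFDerivAt.comp_hasDerivAt (l := G) (f := fun t => (e.1, t)) e.2 hG.hasFDerivAt
        ((hasDerivAt_const _ _).prodMk (hasDerivAt_id _))
    intro s
    rw [← h1.unique hc, ← smul_eq_mul, ← map_smul, Prod.smul_mk, smul_zero, smul_eq_mul, mul_one]
  let L : X × ℂ →L[ℂ] X × ℂ := (ContinuousLinearMap.fst ℂ X ℂ).prod G'
  have hL : ∀ z, L z = (z.1, G' z) := fun z => rfl
  have hsplit : ∀ z : X × ℂ, G' z = G' (z.1, 0) + z.2 * c := fun z => by
    rw [← hG'c, ← map_add]; simp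
  refine ⟨ContinuousLinearEquiv.ofBijective L ?_ ?_, ?_⟩
  · refine LinearMap.ker_eq_bot'.2 fun z hz => ?_
    have hz' : (z.1, G' z) = 0 := hz
    obtain ⟨h1, h2⟩ := Prod.mk_eq_zero.1 hz'
    rw [hsplit z, h1, ← Prod.zero_eq_mk, map_zero, zero_add] at h2
    have : z.2 = 0 := by simpa [h0] using h2
    exact Prod.ext h1 this
  · refine LinearMap.range_eq_top.2 fun z => ⟨(z.1, (z.2 - G' (z.1, 0)) / c), ?_⟩
    refine Prod.ext rfl ?_
    change G' (z.1, (z.2 - G' (z.1, 0)) / c) = z.2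
    refine (hsplit (z.1, (z.2 - G' (z.1, 0)) / c)).trans ?_
    rw [div_mul_cancel₀ _ h0, add_sub_cancel]
  · rw [ContinuousLinearEquiv.coe_ofBijective]
    exact hasStrictFDerivAt_fst.prodMk hG

/-- The projection of the zero set of `G` to the first coordinate is a local homeomorphism at the
points where the derivative of `G` in the last coordinate does not vanish. -/
theorem exists_openPartialHomeomorph_zeroLocus {X : Type*} [NormedAddCommGroup X] [NormedSpace ℂ X]
    [CompleteSpace X] {G : X × ℂ → ℂ} (e : {z : X × ℂ // G z = 0}) {c : ℂ}
    {G' : X × ℂ →L[ℂ] ℂ} (hG : HasStrictFDerivAt G G' e.1)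
    (hc : HasDerivAt (fun t => G (e.1.1, t)) c e.1.2) (h0 : c ≠ 0) :
    ∃ φ : OpenPartialHomeomorph {z : X × ℂ // G z = 0} X,
      e ∈ φ.source ∧ φ = fun z : {z : X × ℂ // G z = 0} => z.1.1 := by
  classical
  obtain ⟨Φ, hΦ⟩ := exists_hasStrictFDerivAt_fst_prod hG hc h0
  let ψ := hΦ.toOpenPartialHomeomorph
  have hψ : ∀ z, ψ z = (z.1, G z) := fun z => rfl
  have hmem : ∀ a, (a, (0 : ℂ)) ∈ ψ.target → G (ψ.symm (a, 0)) = 0 ∧ (ψ.symm (a, 0)).1 = a := by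
    intro a ha
    have := ψ.right_inv ha
    rw [hψ, Prod.mk_inj] at this
    exact ⟨this.2, this.1⟩
  let inv : X → {z : X × ℂ // G z = 0} := fun a =>
    if h : (a, (0 : ℂ)) ∈ ψ.target then ⟨ψ.symm (a, 0), (hmem a h).1⟩ else e
  have hinv : ∀ a, (a, (0 : ℂ)) ∈ ψ.target → (inv a).1 = ψ.symm (a, 0) := by
    intro a ha; simp [inv, ha]
  have hz : ∀ z : {z : X × ℂ // G z = 0}, ψ z.1 = (z.1.1, 0) := fun z => by rw [hψ, z.2]
  refine ⟨{ toFun := fun z => z.1.1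
            invFun := inv
            source := {z | z.1 ∈ ψ.source}
            target := {a | (a, (0 : ℂ)) ∈ ψ.target}
            map_source' := fun z hzs => ?_
            map_target' := fun a ha => ?_
            left_inv' := fun z hzs => ?_
            right_inv' := fun a ha => ?_
            open_source := ψ.open_source.preimage continuous_subtype_val
            open_target := ψ.open_target.preimage (by fun_prop)
            continuousOn_toFun := by fun_prop
            continuousOn_invFun := ?_ }, ?_, rfl⟩
  · have := ψ.map_source hzs
    rwa [hz] at this
  · change (inv a).1 ∈ ψ.source
    rw [hinv a ha]
    exact ψ.map_target ha
  · have h1 := ψ.map_source hzs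
    rw [hz] at h1
    refine Subtype.ext ?_
    rw [hinv _ h1, ← hz, ψ.left_inv hzs]
  · rw [hinv a ha]
    exact (hmem a ha).2
  · refine (Topology.IsInducing.subtypeVal (t := {z | G z = 0})).continuousOn_iff.2 ?_
    refine ContinuousOn.congr ?_ fun a ha => hinv a ha
    exact ψ.continuousOn_symm.comp (by fun_prop) fun a ha => ha
  · exact hΦ.mem_toOpenPartialHomeomorph_source

/-- A continuous solution of an equation `G (a, t) = 0` with nonvanishing derivative in `t` is
differentiable. -/
theorem differentiableAt_of_implicit {X : Type*} [NormedAddCommGroup X] [NormedSpace ℂ X]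
    [CompleteSpace X] {G : X × ℂ → ℂ} {a : X} {θ : X → ℂ} (hθ : ContinuousAt θ a)
    (hz : ∀ᶠ b in nhds a, G (b, θ b) = 0) {c : ℂ}
    {G' : X × ℂ →L[ℂ] ℂ} (hG : HasStrictFDerivAt G G' (a, θ a))
    (hc : HasDerivAt (fun t => G (a, t)) c (θ a)) (h0 : c ≠ 0) :
    DifferentiableAt ℂ θ a := by
  obtain ⟨Φ, hΦ⟩ := exists_hasStrictFDerivAt_fst_prod hG hc h0
  have hcont : Filter.Tendsto (fun b => (b, θ b)) (nhds a) (nhds (a, θ a)) :=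
    continuousAt_id.prodMk hθ
  set ψ := HasStrictFDerivAt.localInverse _ _ _ hΦ
  have h1 := hcont.eventually hΦ.eventually_left_inverse
  have h2 : DifferentiableAt ℂ ψ (a, 0) := by
    have := hΦ.to_localInverse.hasFDerivAt.differentiableAt
    rwa [hz.self_of_nhds] at this
  have h3 : DifferentiableAt ℂ (fun b => (ψ (b, 0)).2) a :=
    DifferentiableAt.snd (DifferentiableAt.comp (g := ψ) (f := fun b => (b, (0 : ℂ)))
      a h2 (by fun_prop))
  refine h3.congr_of_eventuallyEq ?_
  filter_upwards [h1, hz] with b hb hb0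
  rw [hb0] at hb
  exact (congrArg Prod.snd hb).symm

/-- The value at `(a, t)` of a polynomial in `t` whose coefficients are polynomials in `a`. -/
noncomputable def evalPair {n : ℕ} (P : Polynomial (MvPolynomial (Fin n) ℂ))
    (z : (Fin n → ℂ) × ℂ) : ℂ :=
  (P.map (eval z.1)).eval z.2

theorem MvPolynomial.contDiff_eval {n : ℕ} (p : MvPolynomial (Fin n) ℂ) :
    ContDiff ℂ 1 fun a : Fin n → ℂ => eval a p := by
  induction p using MvPolynomial.induction_on with
  | C c => simpa using contDiff_const
  | add p q hp hq => simpa using hp.add hq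
  | mul_X p i hp => simpa using hp.mul (contDiff_apply ℂ ℂ i)

theorem contDiff_evalPair {n : ℕ} (P : Polynomial (MvPolynomial (Fin n) ℂ)) :
    ContDiff ℂ 1 (evalPair P) := by
  unfold evalPair
  induction P using Polynomial.induction_on with
  | C c =>
    simp only [Polynomial.map_C, Polynomial.eval_C]
    exact (contDiff_eval c).comp contDiff_fst
  | add p q hp hq => simpa using hp.add hq
  | monomial k c h => simpa [pow_succ, mul_assoc] using h.mul contDiff_snd

theorem hasDerivAt_evalPair {n : ℕ} (P : Polynomial (MvPolynomial (Fin n) ℂ)) (a : Fin n → ℂ)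
    (t : ℂ) : HasDerivAt (fun t => evalPair P (a, t)) (evalPair P.derivative (a, t)) t := by
  have := (P.map (eval a)).hasDerivAt t
  rwa [Polynomial.derivative_map] at this

theorem isProperMap_fst_evalPair {n : ℕ} {P : Polynomial (MvPolynomial (Fin n) ℂ)}
    (hP : P.Monic) :
    IsProperMap fun e : {z : (Fin n → ℂ) × ℂ // evalPair P z = 0} => e.1.1 := by
  rw [isProperMap_iff_isCompact_preimage]
  refine ⟨by fun_prop, fun K hK => ?_⟩
  obtain ⟨C, hC, m, h⟩ := PolyBdd.of_root
    (a := fun e : {z : (Fin n → ℂ) × ℂ // evalPair P z = 0} => e.1.1)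
    (g := fun e => e.1.2) hP (fun e => e.2)
  obtain ⟨B, hB⟩ := hK.isBounded.exists_norm_le
  have hcl : Topology.IsClosedEmbedding
      (Subtype.val : {z : (Fin n → ℂ) × ℂ // evalPair P z = 0} → _) :=
    (isClosed_eq (contDiff_evalPair P).continuous continuous_const).isClosedEmbedding_subtypeVal
  have hKB := hcl.isCompact_preimage
    (hK.prod (isCompact_closedBall (0 : ℂ) (C * (1 + B) ^ m)))
  convert hKB using 1
  ext e
  simp only [Set.mem_preimage, Set.mem_prod, mem_closedBall_zero_iff]
  refine ⟨fun he => ⟨he, (h e).trans ?_⟩, fun he => he.1⟩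
  have := hB _ he
  gcongr

theorem finite_fiber_evalPair {n : ℕ} {P : Polynomial (MvPolynomial (Fin n) ℂ)}
    (hP : P.Monic) (a : Fin n → ℂ) :
    ((fun e : {z : (Fin n → ℂ) × ℂ // evalPair P z = 0} => e.1.1) ⁻¹' {a}).Finite := by
  have hne : P.map (eval a) ≠ 0 := (hP.map _).ne_zero
  refine Set.Finite.of_finite_image (f := fun e => e.1.2)
    (((P.map (eval a)).rootSet_finite ℂ).subset ?_) ?_
  · rintro _ ⟨⟨⟨b, t⟩, he⟩, rfl, rfl⟩
    rw [Polynomial.mem_rootSet_of_ne hne]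
    simpa [evalPair] using he
  · rintro ⟨⟨b, t⟩, he⟩ hb ⟨⟨b', t'⟩, he'⟩ hb' h
    have h1 : b = a := hb
    have h2 : b' = a := hb'
    have h3 : t = t' := h
    subst h1 h2 h3
    rfl

/-- A monic polynomial with coefficients polynomial in `a` has a holomorphic root on every ball
over which it is separable. -/
theorem exists_differentiableOn_root {n : ℕ} {P : Polynomial (MvPolynomial (Fin n) ℂ)}
    (hP : P.Monic) (hdeg : P.natDegree ≠ 0) {c : Fin n → ℂ} {r : ℝ} (hr : 0 < r)
    (hsep : ∀ a ∈ Metric.ball c r, ∀ t, evalPair P (a, t) = 0 →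
      evalPair P.derivative (a, t) ≠ 0) :
    ∃ θ : (Fin n → ℂ) → ℂ, DifferentiableOn ℂ θ (Metric.ball c r) ∧
      ∀ a ∈ Metric.ball c r, evalPair P (a, θ a) = 0 := by
  classical
  have hstrict : ∀ z, ∃ G' : (Fin n → ℂ) × ℂ →L[ℂ] ℂ, HasStrictFDerivAt (evalPair P) G' z :=
    fun z => ⟨_, (contDiff_evalPair P).contDiffAt.hasStrictFDerivAt one_ne_zero⟩
  have hcov : IsCoveringMapOn (fun e : {z : (Fin n → ℂ) × ℂ // evalPair P z = 0} => e.1.1)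
      (Metric.ball c r) := by
    refine (isProperMap_fst_evalPair hP).isClosedMap.isCoveringMapOn_of_isLocalHomeomorphOn
      (fun a _ => finite_fiber_evalPair hP a) (IsLocalHomeomorphOn.mk _ _ fun e he => ?_)
    obtain ⟨G', hG'⟩ := hstrict e.1
    obtain ⟨φ, h1, h2⟩ := exists_openPartialHomeomorph_zeroLocus e hG'
      (hasDerivAt_evalPair P e.1.1 e.1.2) (hsep _ he _ e.2)
    exact ⟨φ, h1, fun z _ => by rw [h2]⟩
  have := Metric.contractibleSpace_ball (x := c) hr
  have : LocallyPathConnectedSpace (Metric.ball c r) :=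
    Metric.isOpen_ball.locallyPathConnectedSpace
  obtain ⟨t₀, ht₀⟩ := Complex.exists_root (f := P.map (eval c)) (by
    rw [hP.degree_map]
    exact Polynomial.natDegree_pos_iff_degree_pos.1 (Nat.pos_of_ne_zero hdeg))
  obtain ⟨F, ⟨-, hF⟩, -⟩ := hcov.existsUnique_continuousMap_lifts
    (⟨Subtype.val, continuous_subtype_val⟩ : C(Metric.ball c r, Fin n → ℂ))
    (a₀ := ⟨c, Metric.mem_ball_self hr⟩) (e₀ := ⟨(c, t₀), ht₀⟩) rfl (fun a => a.2)
  let θ : (Fin n → ℂ) → ℂ := fun a => if h : a ∈ Metric.ball c r then (F ⟨a, h⟩).1.2 else 0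
  have hθ : ∀ a : Metric.ball c r, (F a).1 = (a.1, θ a.1) := by
    intro a
    refine Prod.ext (congrFun hF a) ?_
    change (F a).1.2 = θ a.1
    simp only [θ, dif_pos a.2]
  have hroot : ∀ a ∈ Metric.ball c r, evalPair P (a, θ a) = 0 := fun a ha => by
    have := (F ⟨a, ha⟩).2
    rwa [hθ] at this
  have hcont : ContinuousOn θ (Metric.ball c r) := by
    rw [continuousOn_iff_continuous_domRestrict]
    have : (Metric.ball c r).domRestrict θ = fun a => (F a).1.2 := by
      ext a; rw [hθ]; rfl
    rw [this]
    fun_prop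
  refine ⟨θ, fun a ha => DifferentiableAt.differentiableWithinAt ?_, hroot⟩
  have hnhds := Metric.isOpen_ball.mem_nhds ha
  obtain ⟨G', hG'⟩ := hstrict (a, θ a)
  exact differentiableAt_of_implicit (hcont.continuousAt hnhds)
    (Filter.mem_of_superset hnhds hroot) hG' (hasDerivAt_evalPair P a (θ a))
    (hsep a ha _ (hroot a ha))

/-- A nonvanishing holomorphic function on a ball has a holomorphic logarithm. -/
theorem exists_differentiableOn_log {E : Type*} [NormedAddCommGroup E] [NormedSpace ℂ E]
    {c : E} {r : ℝ} (hr : 0 < r)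
    {α : E → ℂ} (hα : DifferentiableOn ℂ α (Metric.ball c r))
    (h0 : ∀ a ∈ Metric.ball c r, α a ≠ 0) :
    ∃ f : E → ℂ, DifferentiableOn ℂ f (Metric.ball c r) ∧
      (∀ a ∈ Metric.ball c r, exp (f a) = α a) ∧ |(f c).im| ≤ Real.pi := by
  have : NormedSpace ℝ E := NormedSpace.restrictScalars ℝ ℂ E
  have hsc : IsSimplyConnected (Metric.ball c r) := by
    have := Metric.contractibleSpace_ball (x := c) hr
    change SimplyConnectedSpace _
    infer_instance
  obtain ⟨f₀, hf₀c, hf₀⟩ := exists_continuousOn_eqOn_exp_comp hsc Metric.isOpen_ball hα.continuousOn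
    (fun ⟨a, ha, h⟩ => h0 a ha h)
  have hc := Metric.mem_ball_self hr (x := c)
  let f : E → ℂ := fun a => f₀ a + (log (α c) - f₀ c)
  have hexp : ∀ a ∈ Metric.ball c r, exp (f a) = α a := by
    intro a ha
    have h1 : exp (f₀ c) = α c := hf₀ hc
    have h2 : exp (f₀ a) = α a := hf₀ ha
    simp only [f]
    rw [exp_add, exp_sub, exp_log (h0 c hc), h1, h2, div_self (h0 c hc), mul_one]
  have hcont : ContinuousOn f (Metric.ball c r) := hf₀c.add continuousOn_const
  refine ⟨f, fun a ha => DifferentiableAt.differentiableWithinAt ?_, hexp, ?_⟩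
  · have hnhds := Metric.isOpen_ball.mem_nhds ha
    have hev : ∀ᶠ b in nhds a, ‖f b - f a‖ < Real.pi := by
      have h1 := (hcont.continuousAt hnhds).sub_const (f a)
      have h2 := h1.norm
      rw [sub_self, norm_zero] at h2
      exact h2.eventually (gt_mem_nhds Real.pi_pos)
    have hd : DifferentiableAt ℂ (fun b => f a + log (α b / α a)) a := by
      refine (DifferentiableAt.clog ?_ ?_).const_add _
      · simp only [div_eq_mul_inv]
        exact ((hα a ha).differentiableAt hnhds).mul_const _
      · rw [div_self (h0 a ha)]
        exact one_mem_slitPlane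
    refine hd.congr_of_eventuallyEq ?_
    filter_upwards [hev, hnhds] with b hb hbm
    rw [← hexp a ha, ← hexp b hbm, ← exp_sub]
    have him := (abs_im_le_norm (f b - f a)).trans_lt hb
    rw [abs_lt] at him
    rw [log_exp him.1 him.2.le, add_sub_cancel]
  · simp only [f, add_sub_cancel, log_im]
    exact abs_arg_le_pi _

/-- A holomorphic function with bounded real part on a ball is Lipschitz on a smaller ball. -/
theorem norm_sub_le_of_abs_re_le {E : Type*} [NormedAddCommGroup E] [NormedSpace ℂ E]
    {c : E} {r M : ℝ} (hr : 0 < r) (hM : 0 < M) {f : E → ℂ}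
    (hf : DifferentiableOn ℂ f (Metric.ball c r))
    (hre : ∀ a ∈ Metric.ball c r, |(f a).re| ≤ M) {a b : E}
    (ha : a ∈ Metric.closedBall c (r / 4)) (hb : b ∈ Metric.closedBall c (r / 4)) :
    ‖f a - f b‖ ≤ 16 * M / r * ‖a - b‖ := by
  rcases eq_or_ne a b with rfl | hab
  · simp
  have hu : 0 < ‖a - b‖ := norm_pos_iff.2 (sub_ne_zero.2 hab)
  rw [Metric.mem_closedBall, dist_eq_norm] at ha hb
  have hu2 : ‖a - b‖ ≤ r / 2 := by
    have := norm_sub_le (a - c) (b - c)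
    rw [sub_sub_sub_cancel_right] at this
    linarith
  set R := (3 * r / 4) / ‖a - b‖
  have hR1 : 1 < R := by rw [one_lt_div hu]; linarith
  have hmaps : ∀ z ∈ Metric.ball (0 : ℂ) R, b + z • (a - b) ∈ Metric.ball c r := by
    intro z hz
    rw [mem_ball_zero_iff, lt_div_iff₀ hu] at hz
    rw [Metric.mem_ball, dist_eq_norm, add_sub_right_comm]
    have := norm_add_le (b - c) (z • (a - b))
    rw [norm_smul] at this
    linarith
  have h := borelCaratheodory_zero (f := fun z => f (b + z • (a - b)) - f b) (M := 2 * M) (R := R)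
    (z := 1) (by positivity) ?_ ?_ (by linarith) (by simpa using hR1) (by simp)
  · simp only [one_smul, add_sub_cancel, norm_one, mul_one] at h
    refine h.trans ?_
    have hRu : R - 1 = (3 * r / 4 - ‖a - b‖) / ‖a - b‖ := by
      rw [sub_div, div_self hu.ne']
    rw [hRu, div_div_eq_mul_div, div_mul_eq_mul_div, div_le_div_iff₀ (by linarith) hr]
    nlinarith [mul_pos hM hu]
  · refine DifferentiableOn.sub_const ?_ _
    exact DifferentiableOn.comp (g := f) (f := fun z : ℂ => b + z • (a - b)) hf (by fun_prop) hmaps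
  · intro z hz
    have h1 := hre _ (hmaps z hz)
    have h2 := hre b (by simpa using hmaps 0 (by simpa using zero_lt_one.trans hR1))
    rw [abs_le] at h1 h2
    simp only [Set.mem_ofPred_eq, sub_re]
    linarith

theorem eventually_log_le {A R η : ℝ} (hR : 0 < R) (hη : 0 < η) (m : ℕ) :
    ∀ᶠ N : ℕ in Filter.atTop, A + m * Real.log (1 + N * R) ≤ η * N := by
  have hx : Filter.Tendsto (fun N : ℕ => 1 + (N : ℝ) * R) Filter.atTop Filter.atTop :=
    Filter.tendsto_atTop_add_const_left _ _
      (tendsto_natCast_atTop_atTop.atTop_mul_const hR)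
  set κ := η / (2 * R * (m + 1))
  have hκ : 0 < κ := by positivity
  have h1 := hx.eventually (Real.isLittleO_log_id_atTop.bound hκ)
  have h2 : ∀ᶠ N : ℕ in Filter.atTop, (A + m * κ) / (η / 2) ≤ N :=
    tendsto_natCast_atTop_atTop.eventually_ge_atTop _
  filter_upwards [h1, h2] with N hN1 hN2
  have hpos : (0 : ℝ) ≤ 1 + N * R := by positivity
  have h3 : Real.log (1 + N * R) ≤ κ * (1 + N * R) := by
    refine (le_abs_self _).trans (hN1.trans_eq ?_)
    rw [id, Real.norm_of_nonneg hpos]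
  rw [div_le_iff₀ (by positivity)] at hN2
  have h4 : m * κ * R ≤ η / 2 := by
    have : (m + 1) * κ * R = η / 2 := by
      simp only [κ]
      field_simp
    nlinarith [mul_pos hκ hR]
  have hm : (0 : ℝ) ≤ m := by positivity
  have hN0 : (0 : ℝ) ≤ N := by positivity
  nlinarith [mul_le_mul_of_nonneg_left h3 hm, mul_le_mul_of_nonneg_right h4 hN0]

/-- Polynomially bounded functions with a lower bound on the denominator have logarithms of
size `o(N)` at distance `O(N)` from the origin. -/
theorem eventually_log_norm_le {E : Type*} {n : ℕ} {a : E → Fin n → ℂ} {g : E → ℂ}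
    (hg : PolyBdd a g) {c R η : ℝ} (hc : 0 < c) (hR : 0 < R) (hη : 0 < η) :
    ∀ᶠ N : ℕ in Filter.atTop, ∀ e, ∀ d : ℂ, ‖a e‖ ≤ N * R → c ≤ ‖d‖ → g e ≠ 0 →
      Real.log ‖g e / d‖ ≤ η * N := by
  obtain ⟨C, hC, m, h⟩ := hg
  filter_upwards [eventually_log_le (A := Real.log ((C + 1) / c)) hR hη m] with N hN e d ha hd hge
  refine le_trans ?_ hN
  have hpos : (0 : ℝ) < 1 + N * R := by positivity
  have hd0 : 0 < ‖d‖ := hc.trans_le hd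
  rw [← Real.log_pow, ← Real.log_mul (by positivity) (by positivity)]
  refine Real.log_le_log ?_ ?_
  · rw [norm_div]
    exact div_pos (norm_pos_iff.2 hge) hd0
  · rw [norm_div, div_mul_eq_mul_div]
    refine div_le_div₀ (by positivity) ((h e).trans ?_) hc hd
    refine mul_le_mul (by linarith) ?_ (by positivity) (by linarith)
    gcongr

/-- An algebraic family of multivalued functions `α_i`, without zeros outside a hypersurface, has
a point with `α_i (a) = exp (a_i)` for all `i`. -/
theorem exists_evalPair_eq_mul_exp {n : ℕ} {P : Polynomial (MvPolynomial (Fin n) ℂ)}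
    (hP : P.Monic) (hdeg : P.natDegree ≠ 0) {δ : MvPolynomial (Fin n) ℂ} (hδ : δ ≠ 0)
    (hsep : ∀ a t, eval a δ ≠ 0 → evalPair P (a, t) = 0 → evalPair P.derivative (a, t) ≠ 0)
    (Q Q' : Fin n → Polynomial (MvPolynomial (Fin n) ℂ))
    (hQ : ∀ i z, evalPair P z = 0 → evalPair (Q i) z * evalPair (Q' i) z = eval z.1 δ ^ 2) :
    ∃ a t, eval a δ ≠ 0 ∧ evalPair P (a, t) = 0 ∧
      ∀ i, evalPair (Q i) (a, t) = eval a δ * exp (a i) := by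
  obtain ⟨q, ε, hε, c, hc, N₀, hlow⟩ := exists_norm_eval_lower_bound hδ
  set v : Fin n → ℂ := fun i => 2 * Real.pi * I * (q i : ℂ) with hv
  have hR : 0 < ‖v‖ + ε := by positivity
  have hη : 0 < ε / 64 := by positivity
  let E := {z : (Fin n → ℂ) × ℂ // evalPair P z = 0}
  have hbdd : ∀ F : Polynomial (MvPolynomial (Fin n) ℂ),
      PolyBdd (fun e : E => e.1.1) (fun e => evalPair F e.1) := fun F =>
    PolyBdd.polynomial (a := fun e : E => e.1.1) (g := fun e => e.1.2) F
      (PolyBdd.of_root hP fun e => e.2)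
  have hev := (Filter.eventually_all.2 fun i =>
    eventually_log_norm_le (hbdd (Q i)) hc hR hη).and
    ((Filter.eventually_all.2 fun i => eventually_log_norm_le (hbdd (Q' i)) hc hR hη).and
    ((tendsto_natCast_atTop_atTop.eventually_ge_atTop N₀).and
    ((tendsto_natCast_atTop_atTop.eventually_ge_atTop (Real.pi / (ε / 64))).and
    (Filter.eventually_gt_atTop 0))))
  obtain ⟨N, hN1, hN2, hN3, hN4, hN5⟩ := hev.exists
  rw [div_le_iff₀ hη] at hN4
  have hN : (0 : ℝ) < N := by exact_mod_cast hN5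
  have hNC : (N : ℂ) ≠ 0 := by exact_mod_cast hN5.ne'
  set b : Fin n → ℂ := (N : ℂ) • v
  set r : ℝ := N * ε
  have hr : 0 < r := by positivity
  have hlow' : ∀ a ∈ Metric.ball b r, c ≤ ‖eval a δ‖ ∧ ‖a‖ ≤ N * (‖v‖ + ε) := by
    intro a ha
    have hmem : (N : ℂ)⁻¹ • a ∈ Metric.ball v ε := by
      rw [Metric.mem_ball, dist_eq_norm] at ha ⊢
      have : (N : ℂ)⁻¹ • a - v = (N : ℂ)⁻¹ • (a - b) := by
        rw [smul_sub, inv_smul_smul₀ hNC]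
      rw [this, norm_smul, norm_inv, Complex.norm_natCast, inv_mul_lt_iff₀ hN]
      exact ha
    have h1 := hlow N hN3 _ hmem
    rw [smul_inv_smul₀ hNC] at h1
    refine ⟨h1, ?_⟩
    rw [Metric.mem_ball, dist_eq_norm] at ha
    have h2 := norm_add_le (a - b) b
    rw [sub_add_cancel, norm_smul, Complex.norm_natCast] at h2
    rw [mul_add]
    linarith
  have hδ0 : ∀ a ∈ Metric.ball b r, eval a δ ≠ 0 := fun a ha =>
    norm_pos_iff.1 (hc.trans_le (hlow' a ha).1)
  obtain ⟨θ, hθd, hθ⟩ := exists_differentiableOn_root hP hdeg hr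
    (fun a ha t => hsep a t (hδ0 a ha))
  have hQ0 : ∀ i, ∀ a ∈ Metric.ball b r, evalPair (Q i) (a, θ a) ≠ 0 ∧
      evalPair (Q' i) (a, θ a) ≠ 0 := by
    intro i a ha
    have := hQ i _ (hθ a ha)
    refine ⟨left_ne_zero_of_mul (b := evalPair (Q' i) (a, θ a)) ?_,
      right_ne_zero_of_mul (a := evalPair (Q i) (a, θ a)) ?_⟩ <;>
    · rw [this]
      exact pow_ne_zero _ (hδ0 a ha)
  have hlog : ∀ i, ∃ f : (Fin n → ℂ) → ℂ, DifferentiableOn ℂ f (Metric.ball b r) ∧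
      (∀ a ∈ Metric.ball b r, exp (f a) = evalPair (Q i) (a, θ a) / eval a δ) ∧
      |(f b).im| ≤ Real.pi := by
    intro i
    refine exists_differentiableOn_log hr ?_ fun a ha => div_ne_zero (hQ0 i a ha).1 (hδ0 a ha)
    have h1 : DifferentiableOn ℂ (fun a => evalPair (Q i) (a, θ a)) (Metric.ball b r) :=
      ((contDiff_evalPair (Q i)).differentiable one_ne_zero).comp_differentiableOn
        (differentiableOn_id.prodMk hθd)
    have h2 : DifferentiableOn ℂ (fun a => (eval a δ)⁻¹) (Metric.ball b r) :=
      (((contDiff_eval δ).differentiable one_ne_zero).differentiableOn).inv hδ0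
    exact (h1.mul h2).congr fun a _ => div_eq_mul_inv _ _
  choose f hfd hfe hfb using hlog
  have hre : ∀ i, ∀ a ∈ Metric.ball b r, |(f i a).re| ≤ ε / 64 * N := by
    intro i a ha
    have h1 : (f i a).re = Real.log ‖evalPair (Q i) (a, θ a) / eval a δ‖ := by
      rw [← hfe i a ha, norm_exp, Real.log_exp]
    have h2 := hN1 i ⟨(a, θ a), hθ a ha⟩ (eval a δ) (hlow' a ha).2 (hlow' a ha).1 (hQ0 i a ha).1
    have h3 := hN2 i ⟨(a, θ a), hθ a ha⟩ (eval a δ) (hlow' a ha).2 (hlow' a ha).1 (hQ0 i a ha).2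
    have h4 : evalPair (Q' i) (a, θ a) / eval a δ
        = (evalPair (Q i) (a, θ a) / eval a δ)⁻¹ := by
      have := hQ i _ (hθ a ha)
      rw [inv_div, div_eq_div_iff (hδ0 a ha) (hQ0 i a ha).1, mul_comm, this, sq]
    simp only at h2 h3
    rw [h4, norm_inv, Real.log_inv] at h3
    rw [h1, abs_le]
    constructor <;> linarith
  have hlip : ∀ i, ∀ a ∈ Metric.closedBall b (r / 4), ∀ a' ∈ Metric.closedBall b (r / 4),
      ‖f i a - f i a'‖ ≤ 1 / 4 * ‖a - a'‖ := by
    intro i a ha a' ha'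
    have := norm_sub_le_of_abs_re_le hr (by positivity) (hfd i) (hre i) ha ha'
    convert this using 2
    simp only [r]
    field_simp
    norm_num
  have hbm : b ∈ Metric.closedBall b (r / 4) := Metric.mem_closedBall_self (by positivity)
  have hfb' : ∀ i, ‖f i b‖ ≤ r / 32 := by
    intro i
    refine (norm_le_abs_re_add_abs_im _).trans ?_
    have h1 := hre i b (Metric.mem_ball_self hr)
    have h2 := hfb i
    have h3 : r = N * ε := rfl
    linarith
  let Ψ : (Fin n → ℂ) → Fin n → ℂ := fun a => b + fun i => f i a
  have hmaps : Set.MapsTo Ψ (Metric.closedBall b (r / 4)) (Metric.closedBall b (r / 4)) := by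
    intro a ha
    rw [Metric.mem_closedBall, dist_eq_norm, add_sub_cancel_left,
      pi_norm_le_iff_of_nonneg (by positivity)]
    intro i
    have h1 := hlip i a ha b hbm
    have h2 := norm_add_le (f i a - f i b) (f i b)
    rw [sub_add_cancel] at h2
    have h3 := hfb' i
    rw [Metric.mem_closedBall, dist_eq_norm] at ha
    linarith
  have hcontr : ContractingWith (1 / 4) (hmaps.restrict Ψ _ _) := by
    refine ⟨by norm_num, LipschitzWith.of_dist_le_mul fun a a' => ?_⟩
    rw [Subtype.dist_eq, Subtype.dist_eq, dist_eq_norm, dist_eq_norm]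
    change ‖Ψ a.1 - Ψ a'.1‖ ≤ _
    rw [add_sub_add_left_eq_sub, pi_norm_le_iff_of_nonneg (by positivity)]
    intro i
    simpa using hlip i a.1 a.2 a'.1 a'.2
  obtain ⟨a, ham, hfix, -⟩ := hcontr.exists_fixedPoint'
    (Metric.isClosed_closedBall.isComplete) hmaps hbm (edist_ne_top _ _)
  have hab : a ∈ Metric.ball b r :=
    Metric.closedBall_subset_ball (by linarith) ham
  refine ⟨a, θ a, hδ0 a hab, hθ a hab, fun i => ?_⟩
  have hi : a i = b i + f i a := (congrFun hfix i).symm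
  have hb : exp (b i) = 1 := by
    rw [exp_eq_one_iff]
    refine ⟨N * q i, ?_⟩
    simp only [b, hv, Pi.smul_apply, smul_eq_mul]
    push_cast
    ring
  rw [hi, exp_add, hb, one_mul, hfe i a hab, mul_div_cancel₀ _ (hδ0 a hab)]

/-- A finite separable extension of the fraction field of a domain `A` has an integral generator,
and finitely many elements are, up to a common denominator in `A`, polynomials in it. -/
theorem exists_isIntegral_forall_finset_exists_aeval_eq (A F : Type*) {K : Type*} [CommRing A]
    [IsDomain A] [Field F] [Algebra A F] [IsFractionRing A F] [Field K] [Algebra F K] [Algebra A K]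
    [IsScalarTower A F K] [FiniteDimensional F K] [Algebra.IsSeparable F K] :
    ∃ θ : K, IsIntegral A θ ∧ ∀ s : Finset K, ∃ δ : A, δ ≠ 0 ∧ ∀ r ∈ s, ∃ N : Polynomial A,
      algebraMap A K δ * r = Polynomial.aeval θ N := by
  obtain ⟨α, hα⟩ := Field.exists_primitive_element F K
  have halg : IsAlgebraic A α :=
    (IsFractionRing.isAlgebraic_iff A F K).2 (Algebra.IsAlgebraic.isAlgebraic α)
  obtain ⟨d, hd, hdα⟩ := halg.exists_integral_multiple
  refine ⟨d • α, hdα, fun s => ?_⟩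
  have hdF : algebraMap A F d ≠ 0 := by
    simpa using (IsFractionRing.injective A F).ne hd
  have htop : Algebra.adjoin F {(d • α : K)} = ⊤ := by
    have h1 : IntermediateField.adjoin F {(d • α : K)} = ⊤ := by
      rw [eq_top_iff, ← hα, IntermediateField.adjoin_simple_le_iff]
      have h2 : (algebraMap A F d)⁻¹ • (d • α : K) = α := by
        rw [← algebraMap_smul (A := F) d α, smul_smul, inv_mul_cancel₀ hdF, one_smul]
      have h3 := IntermediateField.smul_mem (IntermediateField.adjoin F {(d • α : K)})
        (x := (algebraMap A F d)⁻¹) (IntermediateField.mem_adjoin_simple_self F (d • α))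
      rwa [h2] at h3
    rw [← IntermediateField.adjoin_simple_toSubalgebra_of_isAlgebraic
      (Algebra.IsAlgebraic.isAlgebraic (R := F) (d • α)), h1, IntermediateField.top_toSubalgebra]
  have hone : ∀ r : K, ∃ δ : A, δ ≠ 0 ∧ ∃ N : Polynomial A,
      algebraMap A K δ * r = Polynomial.aeval (d • α) N := by
    intro r
    have hr : r ∈ Algebra.adjoin F {d • α} := htop ▸ Algebra.mem_top
    rw [Algebra.adjoin_singleton_eq_range_aeval] at hr
    obtain ⟨p, rfl⟩ := hr
    obtain ⟨b, hbmem, hb⟩ := IsLocalization.integerNormalization_spec (nonZeroDivisors A) p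
    refine ⟨b, nonZeroDivisors.ne_zero hbmem, IsLocalization.integerNormalization
      (nonZeroDivisors A) p, ?_⟩
    have := congrArg (Polynomial.aeval (d • α)) hb
    rw [Polynomial.aeval_map_algebraMap] at this
    rw [this]
    rw [← algebraMap_smul F b p, map_smul, algebraMap_smul]
    exact (Algebra.smul_def _ _).symm
  classical
  induction s using Finset.induction_on with
  | empty => exact ⟨1, one_ne_zero, by simp⟩
  | insert r s _ ih =>
    obtain ⟨δ, hδ, h⟩ := ih
    obtain ⟨δ', hδ', N', h'⟩ := hone r
    refine ⟨δ * δ', mul_ne_zero hδ hδ', fun x hx => ?_⟩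
    rcases Finset.mem_insert.1 hx with rfl | hx
    · refine ⟨Polynomial.C δ * N', ?_⟩
      simp [mul_assoc, h']
    · obtain ⟨N, hN⟩ := h x hx
      refine ⟨Polynomial.C δ' * N, ?_⟩
      simp only [map_mul, Polynomial.aeval_C, ← hN]
      ring

/-- If `f : L →+* K` and `g : L →+* C` are such that `g` kills the kernel of `f`, then `g` descends
to every ring `R` mapping to the localization of the range of `f` at a power of `f d`, provided
that `g d ≠ 0`. -/
theorem RingHom.exists_lift_of_ker_le_of_pow_mul {L R K C : Type*} [CommRing L] [CommRing R]
    [CommRing K] [Field C] {f : L →+* K} {g : L →+* C} (hfg : RingHom.ker f ≤ RingHom.ker g)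
    {d : L} (hd : g d ≠ 0) (i : R →+* K) (hi : ∀ r, ∃ m N, f d ^ m * i r = f N) :
    ∃ φ : R →+* C, ∀ r m N, f d ^ m * i r = f N → φ r = g N / g d ^ m := by
  have hwd : ∀ r m N m' N', f d ^ m * i r = f N → f d ^ m' * i r = f N' →
      g N / g d ^ m = g N' / g d ^ m' := by
    intro r m N m' N' h h'
    rw [div_eq_div_iff (pow_ne_zero _ hd) (pow_ne_zero _ hd), ← sub_eq_zero]
    have : N * d ^ m' - N' * d ^ m ∈ RingHom.ker f := by
      rw [RingHom.mem_ker, map_sub, map_mul, map_mul, map_pow, map_pow, ← h, ← h']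
      ring
    simpa using hfg this
  choose m N hN using hi
  have hφ : ∀ r m' N', f d ^ m' * i r = f N' → g (N r) / g d ^ m r = g N' / g d ^ m' :=
    fun r m' N' h => hwd r _ _ _ _ (hN r) h
  refine ⟨{ toFun := fun r => g (N r) / g d ^ m r, map_one' := ?_, map_mul' := fun r s => ?_,
            map_zero' := ?_, map_add' := fun r s => ?_ }, hφ⟩
  · simpa using hφ 1 0 1 (by simp)
  · rw [hφ (r * s) (m r + m s) (N r * N s) (by simp only [map_mul, ← hN]; ring), map_mul, pow_add,
      div_mul_div_comm]
  · simpa using hφ 0 0 0 (by simp)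
  · rw [hφ (r + s) (m r + m s) (d ^ m s * N r + d ^ m r * N s)
      (by simp only [map_add, map_mul, map_pow, ← hN]; ring)]
    have := pow_ne_zero (m r) hd
    have := pow_ne_zero (m s) hd
    simp only [map_add, map_mul, map_pow, pow_add]
    field_simp

theorem evalPair_map_algebraMap {k : Type*} [Field k] [Algebra k ℂ] {n : ℕ}
    (Q : Polynomial (MvPolynomial (Fin n) k)) (a : Fin n → ℂ) (t : ℂ) :
    evalPair (Q.map (MvPolynomial.map (algebraMap k ℂ))) (a, t) =
      Polynomial.eval₂RingHom (aeval a : MvPolynomial (Fin n) k →ₐ[k] ℂ).toRingHom t Q := by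
  unfold evalPair
  rw [Polynomial.map_map, Polynomial.eval_map, Polynomial.coe_eval₂RingHom]
  congr 1
  ext i
  · simp
  · simp

/-- The fraction field of an algebraic extension of finite type is a finite field extension. -/
theorem finiteDimensional_of_isFractionRing (A F R K : Type*) [CommRing A] [IsDomain A] [Field F]
    [Algebra A F] [IsFractionRing A F] [CommRing R] [IsDomain R] [Field K] [Algebra R K]
    [IsFractionRing R K] [Algebra A R] [Algebra A K] [Algebra F K] [IsScalarTower A F K]
    [IsScalarTower A R K] [FaithfulSMul A K] [Algebra.IsAlgebraic A R] [Algebra.FiniteType A R] :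
    FiniteDimensional F K := by
  have : Algebra.IsAlgebraic A K := (IsFractionRing.isAlgebraic_iff' A R K).1 inferInstance
  have : Algebra.IsAlgebraic F K := (IsFractionRing.comap_isAlgebraic_iff (A := A)).1 inferInstance
  have : Algebra.EssFiniteType R K := .of_isLocalization K (nonZeroDivisors R)
  have : Algebra.EssFiniteType A K := .comp A R K
  have : Algebra.EssFiniteType F K := .of_comp A F K
  exact Algebra.finite_of_essFiniteType_of_isAlgebraic

/-- A transcendence basis makes a ring algebraic over the polynomial ring. -/
theorem IsTranscendenceBasis.isAlgebraic_toAlgebra {k R ι : Type*} [Field k] [CommRing R]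
    [Algebra k R] {x : ι → R} (hx : IsTranscendenceBasis k x) :
    letI := (aeval (R := k) x).toAlgebra
    Algebra.IsAlgebraic (MvPolynomial ι k) R := by
  let := (aeval (R := k) x).toAlgebra
  have := hx.isAlgebraic
  refine ⟨fun r => ?_⟩
  obtain ⟨p, hp, hpr⟩ := this.isAlgebraic r
  refine ⟨p.map (hx.1.aevalEquiv.symm : _ →+* MvPolynomial ι k), ?_, ?_⟩
  · rwa [Ne, Polynomial.map_eq_zero_iff (by exact hx.1.aevalEquiv.symm.injective)]
  · rw [Polynomial.aeval_def, Polynomial.eval₂_map, ← hpr, Polynomial.aeval_def]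
    congr 1
    ext a
    obtain ⟨b, rfl⟩ := hx.1.aevalEquiv.surjective a
    simp [RingHom.algebraMap_toAlgebra]

/-- A version of `exists_algHom_apply_eq_exp` with a chosen integral generator `θ` of a field `K`
containing `R`. -/
theorem exists_algHom_apply_eq_exp_of_isIntegral {k R K : Type*} [Field k] [Algebra k ℂ]
    [CommRing R] [Algebra k R] [Algebra.FiniteType k R] [Field K] [Algebra R K]
    [FaithfulSMul R K] {n : ℕ} [Algebra (MvPolynomial (Fin n) k) K]
    [FaithfulSMul (MvPolynomial (Fin n) k) K] {x : Fin n → R}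
    (hx : ∀ c, algebraMap (MvPolynomial (Fin n) k) K c = algebraMap R K (aeval x c)) {θ : K}
    (hθ : IsIntegral (MvPolynomial (Fin n) k) θ)
    (hsep : Polynomial.aeval θ (minpoly (MvPolynomial (Fin n) k) θ).derivative ≠ 0)
    (hden : ∀ s : Finset K, ∃ δ : MvPolynomial (Fin n) k, δ ≠ 0 ∧ ∀ r ∈ s,
      ∃ N : Polynomial (MvPolynomial (Fin n) k), algebraMap _ K δ * r = Polynomial.aeval θ N)
    {y : Fin n → R} (hy : ∀ i, y i ≠ 0) {g : R} (hg : g ≠ 0) :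
    ∃ φ : R →ₐ[k] ℂ, φ g ≠ 0 ∧ ∀ i, φ (y i) = exp (φ (x i)) := by
  classical
  have hiR := FaithfulSMul.algebraMap_injective R K
  set ι := algebraMap R K with hι
  set P := minpoly (MvPolynomial (Fin n) k) θ with hP
  obtain ⟨S, hS⟩ := Algebra.FiniteType.out (R := k) (A := R)
  obtain ⟨δ, hδ, hN⟩ := hden (S.image ι ∪ Finset.univ.image (fun i => ι (y i)) ∪
    Finset.univ.image (fun i => (ι (y i))⁻¹) ∪ {ι g, (ι g)⁻¹, (Polynomial.aeval θ P.derivative)⁻¹})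
  have hdvd : ∀ Q : Polynomial (MvPolynomial (Fin n) k), Polynomial.aeval θ Q = 0 → P ∣ Q :=
    fun Q hQ => minpoly.isIntegrallyClosed_dvd hθ hQ
  choose Q hQ using fun i => hN (ι (y i)) (by simp)
  choose Q' hQ' using fun i => hN (ι (y i))⁻¹ (by simp)
  obtain ⟨G, hG⟩ := hN (ι g) (by simp)
  obtain ⟨G', hG'⟩ := hN (ι g)⁻¹ (by simp)
  obtain ⟨W, hW⟩ := hN (Polynomial.aeval θ P.derivative)⁻¹ (by simp)
  let E : (Fin n → ℂ) → ℂ → Polynomial (MvPolynomial (Fin n) k) →+* ℂ := fun a t =>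
    Polynomial.eval₂RingHom (aeval a : MvPolynomial (Fin n) k →ₐ[k] ℂ).toRingHom t
  have hEC : ∀ a t c, E a t (Polynomial.C c) = aeval a c := fun a t c => by simp [E]
  have hEeq : ∀ a t p q, E a t P = 0 → Polynomial.aeval θ p = Polynomial.aeval θ q →
      E a t p = E a t q := by
    intro a t p q hPt hpq
    obtain ⟨r, hr⟩ := hdvd (p - q) (by rw [map_sub, hpq, sub_self])
    rw [← sub_eq_zero, ← map_sub, hr, map_mul, hPt, zero_mul]
  have hδE : ∀ a, eval a (MvPolynomial.map (algebraMap k ℂ) δ) = aeval a δ := fun a => by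
    rw [eval_map, aeval_def]
  obtain ⟨a, t, hδa, hPt, hexp⟩ := exists_evalPair_eq_mul_exp
    (P := P.map (MvPolynomial.map (algebraMap k ℂ))) ((minpoly.monic hθ).map _)
    (by rw [(minpoly.monic hθ).natDegree_map]; exact (minpoly.natDegree_pos hθ).ne')
    (δ := MvPolynomial.map (algebraMap k ℂ) δ)
    (by rwa [Ne, map_eq_zero_iff _ (map_injective _ (algebraMap k ℂ).injective)])
    (fun a t hδa hPt h0 => by
      rw [Polynomial.derivative_map, evalPair_map_algebraMap] at h0
      rw [evalPair_map_algebraMap] at hPt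
      rw [hδE, ← hEC a t, hEeq a t _ (P.derivative * W) hPt, map_mul, h0, zero_mul] at hδa
      · exact hδa rfl
      · rw [map_mul, ← hW, Polynomial.aeval_C]
        field_simp)
    (fun i => (Q i).map (MvPolynomial.map (algebraMap k ℂ)))
    (fun i => (Q' i).map (MvPolynomial.map (algebraMap k ℂ)))
    (fun i ⟨a, t⟩ hPt => by
      rw [evalPair_map_algebraMap] at hPt
      rw [evalPair_map_algebraMap, evalPair_map_algebraMap, hδE, ← hEC a t, ← map_mul, ← map_pow]
      refine hEeq a t _ _ hPt ?_
      have := hiR.ne (hy i)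
      rw [map_zero] at this
      rw [map_mul, ← hQ, ← hQ', map_pow, Polynomial.aeval_C]
      field_simp)
  rw [evalPair_map_algebraMap] at hPt
  simp only [evalPair_map_algebraMap, hδE] at hexp
  rw [hδE, ← hEC a t] at hδa
  set f : Polynomial (MvPolynomial (Fin n) k) →+* K :=
    (Polynomial.aeval θ).toRingHom with hf
  have hfC : ∀ c, f (Polynomial.C c) = ι (aeval x c) := fun c =>
    (Polynomial.aeval_C _ _).trans (hx c)
  have hfδ : f (Polynomial.C δ) = algebraMap _ _ δ := Polynomial.aeval_C _ _
  have hker : RingHom.ker f ≤ RingHom.ker (E a t) := fun p hp => by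
    have h1 := hEeq a t p 0 hPt (by rw [map_zero]; exact hp)
    rwa [map_zero] at h1
  have hall : ∀ r, ∃ m N, f (Polynomial.C δ) ^ m * ι r = f N := by
    intro r
    have hr : r ∈ Algebra.adjoin k (S : Set R) := hS ▸ Algebra.mem_top
    induction hr using Algebra.adjoin_induction with
    | mem r hr =>
      obtain ⟨N, hN⟩ := hN (ι r) (by
        simp only [Finset.mem_union]
        exact .inl (.inl (.inl (Finset.mem_image_of_mem _ hr))))
      exact ⟨1, N, by rw [pow_one, hfδ]; exact hN⟩
    | algebraMap c => exact ⟨0, Polynomial.C (C c), by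
      rw [pow_zero, one_mul]
      exact (congrArg ι (aeval_C _ _)).symm.trans (hfC _).symm⟩
    | add r s _ _ hr hs =>
      obtain ⟨m, N, h⟩ := hr
      obtain ⟨m', N', h'⟩ := hs
      refine ⟨m + m', Polynomial.C δ ^ m' * N + Polynomial.C δ ^ m * N', ?_⟩
      simp only [map_add, map_mul, map_pow, ← h, ← h']
      ring
    | mul r s _ _ hr hs =>
      obtain ⟨m, N, h⟩ := hr
      obtain ⟨m', N', h'⟩ := hs
      refine ⟨m + m', N * N', ?_⟩
      simp only [map_mul, ← h, ← h']
      ring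
  obtain ⟨φ, hφ⟩ := RingHom.exists_lift_of_ker_le_of_pow_mul hker hδa ι hall
  have hφC : ∀ c, φ (aeval x c) = aeval a c := fun c => by
    rw [hφ _ 0 (Polynomial.C c) (by rw [pow_zero, one_mul, hfC]), hEC, pow_zero, div_one]
  refine ⟨{ φ with commutes' := fun c => by simpa using hφC (C c) }, ?_, fun i => ?_⟩
  · change φ g ≠ 0
    have h1 : E a t (G * G') = E a t (Polynomial.C δ ^ 2) := by
      refine hEeq a t _ _ hPt ?_
      have := hiR.ne hg
      rw [map_zero] at this
      rw [map_mul, ← hG, ← hG', map_pow, Polynomial.aeval_C]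
      field_simp
    rw [hφ g 1 G (by rw [pow_one, hfδ]; exact hG)]
    refine div_ne_zero (fun h => ?_) (pow_ne_zero _ hδa)
    rw [map_mul, h, zero_mul, map_pow] at h1
    exact pow_ne_zero _ hδa h1.symm
  · change φ (y i) = exp (φ (x i))
    have h1 := hφC (X i)
    rw [aeval_X, aeval_X] at h1
    rw [h1, hφ (y i) 1 (Q i) (by rw [pow_one, hfδ]; exact hQ i), pow_one,
      div_eq_iff hδa, mul_comm, hEC]
    exact hexp i

/-- Generic exponential points: if `x` is a transcendence basis of a finitely generated domain `R`
over `k` and the `y i` are nonzero, then some complex point of `Spec R` outside a given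
hypersurface satisfies `y i = exp (x i)`. -/
theorem exists_algHom_apply_eq_exp {k R : Type*} [Field k] [Algebra k ℂ] [CommRing R] [IsDomain R]
    [Algebra k R] [Algebra.FiniteType k R] {n : ℕ} {x : Fin n → R} (hx : IsTranscendenceBasis k x)
    {y : Fin n → R} (hy : ∀ i, y i ≠ 0) {g : R} (hg : g ≠ 0) :
    ∃ φ : R →ₐ[k] ℂ, φ g ≠ 0 ∧ ∀ i, φ (y i) = exp (φ (x i)) := by
  have : CharZero k := (algebraMap k ℂ).charZero
  let : Algebra (MvPolynomial (Fin n) k) R := (aeval x).toAlgebra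
  have : IsScalarTower k (MvPolynomial (Fin n) k) R :=
    IsScalarTower.of_algebraMap_eq' (aeval x).comp_algebraMap.symm
  have hinj : Function.Injective (algebraMap (MvPolynomial (Fin n) k) R) := hx.1
  have : FaithfulSMul (MvPolynomial (Fin n) k) R :=
    (faithfulSMul_iff_algebraMap_injective _ _).2 hinj
  have : Algebra.IsAlgebraic (MvPolynomial (Fin n) k) R := hx.isAlgebraic_toAlgebra
  have : Algebra.FiniteType (MvPolynomial (Fin n) k) R :=
    Algebra.FiniteType.of_restrictScalars_finiteType k _ _
  let := FractionRing.liftAlgebra (MvPolynomial (Fin n) k) (FractionRing R)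
  have : IsScalarTower (MvPolynomial (Fin n) k) (FractionRing (MvPolynomial (Fin n) k))
    (FractionRing R) := FractionRing.isScalarTower_liftAlgebra _ _
  have : CharZero (FractionRing (MvPolynomial (Fin n) k)) :=
    charZero_of_injective_algebraMap
      (IsFractionRing.injective (MvPolynomial (Fin n) k) (FractionRing (MvPolynomial (Fin n) k)))
  have : FiniteDimensional (FractionRing (MvPolynomial (Fin n) k)) (FractionRing R) :=
    finiteDimensional_of_isFractionRing (MvPolynomial (Fin n) k) _ R _
  obtain ⟨θ, hθ, hden⟩ := exists_isIntegral_forall_finset_exists_aeval_eq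
    (MvPolynomial (Fin n) k) (FractionRing (MvPolynomial (Fin n) k)) (K := FractionRing R)
  refine exists_algHom_apply_eq_exp_of_isIntegral (fun c => ?_) hθ ?_ hden hy hg
  · rw [IsScalarTower.algebraMap_apply _ R]
    rfl
  · have h1 := Algebra.IsSeparable.isSeparable (FractionRing (MvPolynomial (Fin n) k)) θ
    have h2 := h1.aeval_derivative_ne_zero (minpoly.aeval (FractionRing _) θ)
    rwa [minpoly.isIntegrallyClosed_eq_field_fractions' (FractionRing (MvPolynomial (Fin n) k)) hθ,
      Polynomial.derivative_map, Polynomial.aeval_map_algebraMap] at h2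

/-- Away from a hypersurface, specializing preserves algebraicity over a transcendence basis. -/
theorem exists_forall_algHom_isAlgebraic {k R B ι : Type*} [Field k] [CommRing R] [IsDomain R]
    [Algebra k R] [CommRing B] [IsDomain B] [Algebra k B] {y : ι → R}
    (hy : IsTranscendenceBasis k y) (r : R) :
    ∃ g : R, g ≠ 0 ∧ ∀ φ : R →ₐ[k] B, φ g ≠ 0 →
      IsAlgebraic (Algebra.adjoin k (Set.range fun i => φ (y i))) (φ r) := by
  obtain ⟨p, hp, hpr⟩ := hy.isAlgebraic.isAlgebraic r
  refine ⟨p.leadingCoeff, by simpa using hp, fun φ hφ => ?_⟩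
  have hmem : ∀ c : Algebra.adjoin k (Set.range y),
      (φ.comp (Algebra.adjoin k (Set.range y)).val) c ∈
        Algebra.adjoin k (Set.range fun i => φ (y i)) := by
    intro c
    have h1 : (Algebra.adjoin k (Set.range y)).map φ =
        Algebra.adjoin k (Set.range fun i => φ (y i)) := by
      rw [AlgHom.map_adjoin, ← Set.range_comp]
      rfl
    rw [← h1]
    exact ⟨c, c.2, rfl⟩
  let ψ := (φ.comp (Algebra.adjoin k (Set.range y)).val).codRestrict _ hmem
  refine ⟨p.map (ψ : _ →+* _), fun h => hφ ?_, ?_⟩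
  · have := congrArg (fun q => ((q.coeff p.natDegree :
      Algebra.adjoin k (Set.range fun i => φ (y i))) : B)) h
    simpa [ψ] using this
  · rw [Polynomial.aeval_def, Polynomial.eval₂_map]
    have := congrArg φ hpr
    rw [Polynomial.aeval_def, ← AlgHom.coe_toRingHom, Polynomial.hom_eval₂] at this
    exact this.trans (map_zero φ)

theorem MvPolynomial.totalDegree_det_le {k σ m : Type*} [CommRing k] [Fintype m] [DecidableEq m]
    (N : Matrix m m (MvPolynomial σ k)) {D : ℕ} (hN : ∀ i j, (N i j).totalDegree ≤ D) :
    N.det.totalDegree ≤ Fintype.card m * D := by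
  rw [Matrix.det_apply]
  refine (totalDegree_finsetSum _ _).trans (Finset.sup_le fun τ _ => ?_)
  have h1 : (∏ i, N (τ i) i).totalDegree ≤ Fintype.card m * D := by
    refine (totalDegree_finsetProd _ _).trans ((Finset.sum_le_card_nsmul _ _ D fun i _ => hN _ _)
      |>.trans ?_)
    simp
  rcases Int.units_eq_one_or (Equiv.Perm.sign τ) with h | h <;> simpa [h] using h1

/-- Multiplication by finitely many elements of `R`, in a suitable family of elements of `R`, is
given by matrices over `A` up to a common denominator. -/
theorem exists_matrix_forall_mul_eq_sum (A F : Type*) {R : Type*} (K : Type*) [CommRing A]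
    [IsDomain A] [Field F] [Algebra A F] [IsFractionRing A F] [CommRing R] [IsDomain R] [Field K]
    [Algebra R K] [IsFractionRing R K] [Algebra A R] [Algebra A K] [Algebra F K]
    [IsScalarTower A F K] [IsScalarTower A R K] [FiniteDimensional F K] {ι : Type*} [Fintype ι]
    (x : ι → R) :
    ∃ (d : ℕ) (u : Fin d → R) (Δ : A) (N : ι → Matrix (Fin d) (Fin d) A),
      d ≠ 0 ∧ Δ ≠ 0 ∧ LinearIndependent A u ∧
      ∀ j c, algebraMap A R Δ * (x j * u c) = ∑ i, algebraMap A R (N j i c) * u i := by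
  classical
  let b := Module.finBasis F K
  obtain ⟨e, he⟩ := IsLocalization.exist_integer_multiples_of_finite (nonZeroDivisors R) b
  choose u hu using he
  obtain ⟨Δ, hΔ⟩ := IsLocalization.exist_integer_multiples_of_finite (nonZeroDivisors A)
    fun q : ι × Fin (Module.finrank F K) × Fin (Module.finrank F K) =>
      b.repr (algebraMap R K (x q.1) * b q.2.2) q.2.1
  choose N hN using hΔ
  have he0 : algebraMap R K e ≠ 0 :=
    IsFractionRing.to_map_ne_zero_of_mem_nonZeroDivisors e.2
  have hu' : ∀ c, algebraMap R K (u c) = algebraMap R K e * b c := fun c => by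
    rw [hu]
    exact Algebra.smul_def _ _
  have hN' : ∀ q, algebraMap A F (N q) = algebraMap A F Δ *
      b.repr (algebraMap R K (x q.1) * b q.2.2) q.2.1 := fun q => by
    rw [hN]
    exact Algebra.smul_def _ _
  refine ⟨_, u, Δ, fun j => .of fun i c => N (j, i, c), Module.finrank_pos.ne',
    nonZeroDivisors.ne_zero Δ.2, ?_, fun j c => IsFractionRing.injective R K ?_⟩
  · rw [Fintype.linearIndependent_iff]
    intro v hv
    have h1 : ∑ c, algebraMap A F (v c) • b c = 0 := by
      have h2 := congrArg (algebraMap R K) hv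
      rw [map_sum, map_zero] at h2
      refine (mul_eq_zero (a := algebraMap R K e) |>.1 ?_).resolve_left he0
      rw [Finset.mul_sum, ← h2]
      refine Finset.sum_congr rfl fun c _ => ?_
      rw [Algebra.smul_def, Algebra.smul_def, map_mul, hu', ← IsScalarTower.algebraMap_apply,
        ← IsScalarTower.algebraMap_apply, mul_left_comm]
    intro c
    have := Fintype.linearIndependent_iff.1 b.linearIndependent _ h1 c
    rwa [map_eq_zero_iff _ (IsFractionRing.injective A F)] at this
  · simp only [map_mul, map_sum, hu', ← IsScalarTower.algebraMap_apply]
    have h1 := congrArg (fun z => algebraMap R K e * algebraMap A K Δ * z)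
      (b.sum_repr (algebraMap R K (x j) * b c)).symm
    simp only [Finset.mul_sum] at h1
    rw [show algebraMap A K Δ * (algebraMap R K (x j) * (algebraMap R K e * b c)) =
      algebraMap R K e * algebraMap A K Δ * (algebraMap R K (x j) * b c) by ring, h1]
    refine Finset.sum_congr rfl fun i _ => ?_
    rw [Matrix.of_apply, IsScalarTower.algebraMap_apply A F K (N _), hN', (algebraMap F K).map_mul,
      ← IsScalarTower.algebraMap_apply, Algebra.smul_def]
    ring

/-- Integral linear relations among the specializations of algebraically independent elements force
the specialization of a transcendence basis onto a hypersurface of bounded degree. -/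
theorem exists_forall_algHom_exists_totalDegree_le {k R B : Type*} [Field k]
    [CommRing R] [IsDomain R] [Algebra k R] [Algebra.FiniteType k R] [CommRing B] [IsDomain B]
    [Algebra k B] {n : ℕ} {y : Fin n → R} (hy : IsTranscendenceBasis k y) {x : Fin n → R}
    (hx : LinearIndependent ℤ x) :
    ∃ g : R, g ≠ 0 ∧ ∃ D : ℕ, ∀ φ : R →ₐ[k] B, φ g ≠ 0 → ∀ m : Fin n → ℤ, m ≠ 0 →
      ∑ j, m j • φ (x j) = 0 →
      ∃ Q : MvPolynomial (Fin n) k, Q ≠ 0 ∧ Q.totalDegree ≤ D ∧ aeval (fun i => φ (y i)) Q = 0 := by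
  classical
  let : Algebra (MvPolynomial (Fin n) k) R := (aeval y).toAlgebra
  have : IsScalarTower k (MvPolynomial (Fin n) k) R :=
    IsScalarTower.of_algebraMap_eq' (aeval y).comp_algebraMap.symm
  have hinj : Function.Injective (algebraMap (MvPolynomial (Fin n) k) R) := hy.1
  have : FaithfulSMul (MvPolynomial (Fin n) k) R :=
    (faithfulSMul_iff_algebraMap_injective _ _).2 hinj
  have : Algebra.IsAlgebraic (MvPolynomial (Fin n) k) R := hy.isAlgebraic_toAlgebra
  have : Algebra.FiniteType (MvPolynomial (Fin n) k) R :=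
    Algebra.FiniteType.of_restrictScalars_finiteType k _ _
  let := FractionRing.liftAlgebra (MvPolynomial (Fin n) k) (FractionRing R)
  have : IsScalarTower (MvPolynomial (Fin n) k) (FractionRing (MvPolynomial (Fin n) k))
    (FractionRing R) := FractionRing.isScalarTower_liftAlgebra _ _
  have : FiniteDimensional (FractionRing (MvPolynomial (Fin n) k)) (FractionRing R) :=
    finiteDimensional_of_isFractionRing (MvPolynomial (Fin n) k) _ R _
  obtain ⟨d, u, Δ, N, hd, hΔ, hu, hN⟩ := exists_matrix_forall_mul_eq_sum
    (MvPolynomial (Fin n) k) (FractionRing (MvPolynomial (Fin n) k)) (FractionRing R) x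
  have : NeZero d := ⟨hd⟩
  have halg : ∀ q, algebraMap (MvPolynomial (Fin n) k) R q = aeval y q := fun _ => rfl
  have hφ : ∀ (φ : R →ₐ[k] B) q, φ (aeval y q) = aeval (fun i => φ (y i)) q := fun φ q => by
    rw [← AlgHom.comp_apply, comp_aeval]
  simp only [halg] at hN
  refine ⟨u 0 * aeval y Δ, mul_ne_zero (hu.ne_zero 0) ?_, d * Finset.univ.sup fun q :
    Fin n × Fin d × Fin d => (N q.1 q.2.1 q.2.2).totalDegree, fun φ hφ0 m hm hrel => ?_⟩
  · rwa [← halg, Ne, map_eq_zero_iff _ hinj]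
  rw [map_mul, mul_ne_zero_iff] at hφ0
  have hsum : ∀ z : Fin n → ℤ, ∀ c, aeval y Δ * ((∑ j, z j • x j) * u c) =
      ∑ i, aeval y ((∑ j, z j • N j) i c) * u i := by
    intro z c
    simp only [Finset.sum_mul, Finset.mul_sum, Matrix.sum_apply, map_sum, smul_mul_assoc,
      mul_smul_comm, hN, Finset.smul_sum, Matrix.smul_apply, map_zsmul]
    exact Finset.sum_comm
  refine ⟨(∑ j, m j • N j).det, fun h0 => ?_, ?_, ?_⟩
  · obtain ⟨v, hv, hv0⟩ := Matrix.exists_mulVec_eq_zero_iff.2 h0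
    have h1 : (aeval y Δ * ∑ j, m j • x j) * ∑ c, aeval y (v c) * u c = 0 := by
      calc _ = ∑ c, aeval y (v c) * (aeval y Δ * ((∑ j, m j • x j) * u c)) := by
            rw [Finset.mul_sum]
            exact Finset.sum_congr rfl fun _ _ => by ring
        _ = ∑ i, aeval y (((∑ j, m j • N j).mulVec v) i) * u i := by
            simp only [hsum]
            simp only [Matrix.mulVec, dotProduct, Finset.mul_sum, Finset.sum_mul, map_sum,
              map_mul]
            rw [Finset.sum_comm]
            exact Finset.sum_congr rfl fun _ _ => Finset.sum_congr rfl fun _ _ => by ring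
        _ = 0 := by simp only [hv0, Pi.zero_apply, map_zero, zero_mul, Finset.sum_const_zero]
    have hΔ0 : aeval y Δ ≠ 0 := by rwa [← halg, Ne, map_eq_zero_iff _ hinj]
    have hx0 : ∑ j, m j • x j ≠ 0 := fun h =>
      hm (funext (Fintype.linearIndependent_iff.1 hx m h))
    exact hv (funext (Fintype.linearIndependent_iff.1 hu v
      ((mul_eq_zero.1 h1).resolve_left (mul_ne_zero hΔ0 hx0))))
  · refine (totalDegree_det_le _ fun i c => ?_).trans_eq (by rw [Fintype.card_fin])
    rw [Matrix.sum_apply]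
    refine (totalDegree_finsetSum _ _).trans (Finset.sup_le fun j _ => ?_)
    refine (totalDegree_smul_le _ _).trans ?_
    exact Finset.le_sup (f := fun q : Fin n × Fin d × Fin d => (N q.1 q.2.1 q.2.2).totalDegree)
      (Finset.mem_univ (j, i, c))
  · have h1 : (aeval (fun i => φ (y i)) : _ →ₐ[k] B) (∑ j, m j • N j).det =
        (((aeval (fun i => φ (y i)) : _ →ₐ[k] B).mapMatrix) (∑ j, m j • N j)).det :=
      AlgHom.map_det _ _
    rw [h1, ← Matrix.exists_vecMul_eq_zero_iff]
    refine ⟨fun i => φ (u i), fun h => hφ0.1 (congrFun h 0), ?_⟩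
    ext c
    have h2 := congrArg φ (hsum m c)
    simp only [map_mul, map_sum, map_zsmul, hrel, zero_mul, mul_zero, hφ] at h2
    rw [Matrix.vecMul, dotProduct]
    rw [Pi.zero_apply, h2]
    exact Finset.sum_congr rfl fun _ _ => mul_comm _ _

theorem AlgebraicIndependent.mem_matroid_closure_iff {K A : Type*} [CommRing K] [CommRing A]
    [IsDomain A] [Algebra K A] [FaithfulSMul K A] {s : Set A} {z : A} :
    z ∈ (AlgebraicIndependent.matroid K A).closure s ↔ IsAlgebraic (Algebra.adjoin K s) z := by
  rw [AlgebraicIndependent.matroid_closure_eq, SetLike.mem_coe, Subalgebra.mem_algebraicClosure]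

/-- A family that is algebraically spanned by few enough elements, and spans many
algebraically independent elements, is algebraically independent. -/
theorem AlgebraicIndependent.of_card_le_of_forall_isAlgebraic {K A ι : Type*} [Field K]
    [CommRing A] [IsDomain A] [Algebra K A] [Fintype ι] {b : ι → A} {t : Finset A}
    (ht : AlgebraicIndependent K (Subtype.val : ↥(t : Set A) → A)) (hcard : Fintype.card ι ≤ t.card)
    (halg : ∀ x ∈ t, IsAlgebraic (Algebra.adjoin K (Set.range b)) x) :
    AlgebraicIndependent K b ∧ ∀ z : A, IsAlgebraic (Algebra.adjoin K (Set.range b)) z →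
      IsAlgebraic (Algebra.adjoin K (t : Set A)) z := by
  set M := AlgebraicIndependent.matroid K A
  have htI : M.Indep t := ht
  have hsub : (t : Set A) ⊆ M.closure (Set.range b) := fun x hx =>
    AlgebraicIndependent.mem_matroid_closure_iff.2 (halg x hx)
  have htb : (t.card : ℕ∞) ≤ M.eRk (Set.range b) := by
    rw [← M.eRk_closure_eq, ← Set.encard_coe_eq_coe_finsetCard]
    exact htI.encard_le_eRk_of_subset hsub
  have hfin : (Set.range b).Finite := Set.finite_range b
  have hle : (Set.range b).encard ≤ Fintype.card ι := by
    classical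
    rw [← Set.image_univ]
    refine (Set.encard_image_le _ _).trans ?_
    simp
  have hcard' : (Fintype.card ι : ℕ∞) ≤ t.card := by exact_mod_cast hcard
  have hbI : M.Indep (Set.range b) :=
    (M.isRkFinite_of_finite hfin).indep_of_encard_le_eRk (hle.trans (hcard'.trans htb))
  have hinj : Function.Injective b := by
    classical
    have h1 : (Fintype.card ι : ℕ∞) ≤ (Set.range b).encard :=
      hcard'.trans (htb.trans (M.eRk_le_encard _))
    rw [← Set.coe_toFinset (Set.range b), Set.encard_coe_eq_coe_finsetCard] at h1
    have h2 : Fintype.card ι ≤ (Finset.univ.image b).card := by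
      rw [Set.toFinset_range] at h1
      exact_mod_cast h1
    rw [← Set.injOn_univ, ← Finset.coe_univ]
    exact Finset.card_image_iff.1 (le_antisymm Finset.card_image_le h2)
  refine ⟨(algebraicIndependent_subtype_range hinj).1 hbI, fun z hz => ?_⟩
  have hcl : M.closure t = M.closure (M.closure (Set.range b)) := by
    refine (M.isRkFinite_of_finite t.finite_toSet).closure_eq_closure_of_subset_of_eRk_ge_eRk
      hsub ?_
    rw [M.eRk_closure_eq, htI.eRk_eq_encard, Set.encard_coe_eq_coe_finsetCard]
    exact (M.eRk_le_encard _).trans (hle.trans hcard')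
  rw [← AlgebraicIndependent.mem_matroid_closure_iff] at hz ⊢
  rwa [hcl, M.closure_closure]

theorem isAlgebraic_adjoin_iff_of_isAlgebraic {F K A : Type*} [Field F] [Field K] [CommRing A]
    [IsDomain A] [Algebra F K] [Algebra F A] [Algebra K A] [IsScalarTower F K A]
    [Algebra.IsAlgebraic F K] {s : Set A} {z : A} :
    IsAlgebraic (Algebra.adjoin F s) z ↔ IsAlgebraic (Algebra.adjoin K s) z := by
  have h : AlgebraicIndependent.matroid F A = AlgebraicIndependent.matroid K A :=
    Matroid.ext_indep rfl fun I _ => Algebra.IsAlgebraic.algebraicIndependent_iff F K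
  rw [← AlgebraicIndependent.mem_matroid_closure_iff,
    ← AlgebraicIndependent.mem_matroid_closure_iff, h]

theorem zpow_finsetSum {G ι : Type*} [CommGroupWithZero G] {x : G} (hx : x ≠ 0) (s : Finset ι)
    (f : ι → ℤ) : x ^ ∑ i ∈ s, f i = ∏ i ∈ s, x ^ f i := by
  classical
  induction s using Finset.induction_on with
  | empty => simp
  | insert i s hi ih => rw [Finset.sum_insert hi, Finset.prod_insert hi, zpow_add₀ hx, ih]

/-- A polynomial relation between Laurent monomials in algebraically independent elements
forces two monomials of the polynomial to become equal. -/
theorem AlgebraicIndependent.exists_ne_of_aeval_prod_zpow_eq_zero {K L : Type*} [Field K]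
    [Field L] [Algebra K L] {n d : ℕ} {E : Fin d → L} (hE : AlgebraicIndependent K E)
    (e : Fin n → Fin d → ℤ) {Q : MvPolynomial (Fin n) K} (hQ : Q ≠ 0)
    (hQ0 : aeval (fun i => ∏ l, E l ^ e i l) Q = 0) :
    ∃ κ ∈ Q.support, ∃ κ' ∈ Q.support, κ ≠ κ' ∧
      ∀ l, ∑ i, (κ i : ℤ) * e i l = ∑ i, (κ' i : ℤ) * e i l := by
  by_contra! hcon
  have hE0 : ∀ l, E l ≠ 0 := fun l => hE.ne_zero l
  set w : (Fin n →₀ ℕ) → Fin d → ℤ := fun κ l => ∑ i, (κ i : ℤ) * e i l with hw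
  obtain ⟨N, hN⟩ : ∃ N : ℤ, ∀ κ ∈ Q.support, ∀ l, 0 ≤ w κ l + N := by
    refine ⟨∑ κ ∈ Q.support, ∑ l, |w κ l|, fun κ hκ l => ?_⟩
    have h1 : |w κ l| ≤ ∑ l, |w κ l| :=
      Finset.single_le_sum (f := fun l => |w κ l|) (fun _ _ => abs_nonneg _) (Finset.mem_univ l)
    have h2 : ∑ l, |w κ l| ≤ ∑ κ ∈ Q.support, ∑ l, |w κ l| :=
      Finset.single_le_sum (f := fun κ => ∑ l, |w κ l|)
        (fun _ _ => Finset.sum_nonneg fun _ _ => abs_nonneg _) hκ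
    have h3 := neg_abs_le (w κ l)
    linarith
  set u : (Fin n →₀ ℕ) → (Fin d →₀ ℕ) := fun κ =>
    Finsupp.equivFunOnFinite.symm fun l => (w κ l + N).toNat with hu
  set P : MvPolynomial (Fin d) K := ∑ κ ∈ Q.support, monomial (u κ) (coeff κ Q) with hP
  have hmon : ∀ κ ∈ Q.support, aeval E (monomial (u κ) (coeff κ Q)) =
      (∏ l, E l ^ N) * (algebraMap K L (coeff κ Q) * ∏ i, (∏ l, E l ^ e i l) ^ κ i) := by
    intro κ hκ
    rw [aeval_monomial, Finsupp.prod_fintype _ _ (fun _ => pow_zero _)]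
    have h1 : ∀ l, E l ^ (u κ l) = E l ^ N * ∏ i, (E l ^ e i l) ^ κ i := by
      intro l
      have h2 : ((u κ l : ℕ) : ℤ) = N + w κ l := by
        simp only [hu, Finsupp.equivFunOnFinite_symm_apply_apply, Int.toNat_of_nonneg (hN κ hκ l)]
        ring
      rw [← zpow_natCast, h2, zpow_add₀ (hE0 l), hw]
      congr 1
      simp only
      rw [zpow_finsetSum (hE0 l)]
      exact Finset.prod_congr rfl fun i _ => by rw [mul_comm, zpow_mul, zpow_natCast]
    simp_rw [h1]
    rw [Finset.prod_mul_distrib, Finset.prod_comm]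
    simp_rw [Finset.prod_pow]
    ring
  have hP0 : aeval E P = 0 := by
    rw [hP, map_sum, Finset.sum_congr rfl hmon, ← Finset.mul_sum]
    rw [aeval_def, eval₂_eq'] at hQ0
    rw [hQ0, mul_zero]
  have hP1 : P = 0 := algebraicIndependent_iff.1 hE P hP0
  obtain ⟨κ, hκ⟩ := MvPolynomial.support_nonempty.2 hQ
  refine MvPolynomial.mem_support_iff.1 hκ ?_
  have h4 : coeff (u κ) P = coeff κ Q := by
    classical
    rw [hP, coeff_sum, Finset.sum_eq_single κ]
    · simp
    · intro κ' hκ' hne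
      rw [coeff_monomial, if_neg]
      intro heq
      obtain ⟨l, hl⟩ := hcon κ' hκ' κ hκ hne
      apply hl
      have h5 := DFunLike.congr_fun heq l
      simp only [hu, Finsupp.equivFunOnFinite_symm_apply_apply] at h5
      have h6 := hN κ hκ l
      have h7 := hN κ' hκ' l
      change w κ' l = w κ l
      omega
    · exact fun h => (h hκ).elim
  rw [← h4, hP1, coeff_zero]

/-- Assuming Schanuel's conjecture, if complex numbers `c` are `ℤ`-linearly independent and are
algebraic over the field generated by their exponentials, then these exponentials are
algebraically independent. -/
theorem SchanuelConjecture.algebraicIndependent_exp (hSC : SchanuelConjecture) {k : Type*}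
    [Field k] [Algebra k ℂ] [Algebra ℚ k] [Algebra.IsAlgebraic ℚ k] {d : ℕ} {c : Fin d → ℂ}
    (hc : LinearIndependent ℤ c)
    (halg : ∀ j, IsAlgebraic (Algebra.adjoin k (Set.range fun i => exp (c i))) (c j)) :
    AlgebraicIndependent k (fun i => exp (c i)) ∧ TrdegEq ℚ
      (Set.range c ∪ Set.range fun i => exp (c i)) d := by
  have hcQ : LinearIndependent ℚ c := (LinearIndependent.iff_fractionRing ℤ ℚ).1 hc
  obtain ⟨t, hts, htc, htI⟩ := hSC d c
  rw [finrank_span_eq_card hcQ, Fintype.card_fin] at htc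
  have htk : AlgebraicIndependent k (Subtype.val : ↥(t : Set ℂ) → ℂ) := htI.extendScalars k
  have hall : ∀ x ∈ Set.range c ∪ Set.range fun i => exp (c i),
      IsAlgebraic (Algebra.adjoin k (Set.range fun i => exp (c i))) x := by
    rintro x (⟨j, rfl⟩ | hx)
    · exact halg j
    · exact isAlgebraic_algebraMap
        (⟨x, Algebra.subset_adjoin hx⟩ : Algebra.adjoin k (Set.range fun i => exp (c i)))
  obtain ⟨h1, h2⟩ := htk.of_card_le_of_forall_isAlgebraic (b := fun i => exp (c i))
    (by simp [htc]) fun x hx => hall x (hts hx)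
  refine ⟨h1, t, hts, htc, htI, fun x hx => ?_⟩
  rw [IntermediateField.isAlgebraic_adjoin_iff,
    isAlgebraic_adjoin_iff_of_isAlgebraic (F := ℚ) (K := k)]
  exact h2 x (hall x hx)

theorem isAlgebraic_adjoin_of_mem_span_int {k L : Type*} [Field k] [Field L] [Algebra k L]
    {s : Set L} {t : Set L} (ht : ∀ x ∈ t, IsAlgebraic (Algebra.adjoin k s) x) {z : L}
    (hz : z ∈ Submodule.span ℤ t) : IsAlgebraic (Algebra.adjoin k s) z := by
  induction hz using Submodule.span_induction with
  | mem x hx => exact ht x hx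
  | zero => exact isAlgebraic_zero
  | add x y _ _ hx hy => exact hx.add hy
  | smul m x _ hx => exact hx.zsmul m

/-- Assuming Schanuel's conjecture, complex numbers which are algebraic over the field generated
by their exponentials are `ℤ`-linearly independent, provided that linear relations between them
give rise to polynomial relations of bounded degree between their exponentials, and that there
are no linear relations with small coefficients. -/
theorem SchanuelConjecture.linearIndependent (hSC : SchanuelConjecture) {k : Type*}
    [Field k] [Algebra k ℂ] [Algebra ℚ k] [Algebra.IsAlgebraic ℚ k] {n D : ℕ} {a : Fin n → ℂ}
    (halg : ∀ j, IsAlgebraic (Algebra.adjoin k (Set.range fun i => exp (a i))) (a j))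
    (hrel : ∀ m : Fin n → ℤ, m ≠ 0 → ∑ j, m j • a j = 0 → ∃ Q : MvPolynomial (Fin n) k,
      Q ≠ 0 ∧ Q.totalDegree ≤ D ∧ aeval (fun i => exp (a i)) Q = 0)
    (hsmall : ∀ μ : Fin n → ℤ, μ ≠ 0 → (∀ i, |μ i| ≤ D) → ∑ i, μ i • a i ≠ 0) :
    LinearIndependent ℤ a := by
  by_contra hdep
  rw [Fintype.linearIndependent_iff] at hdep
  push Not at hdep
  obtain ⟨m, hm, j, hj⟩ := hdep
  obtain ⟨Q, hQ, hQD, hQ0⟩ := hrel m (fun h => hj (congrFun h j)) hm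
  set W := Submodule.span ℤ (Set.range a)
  have : Module.Finite ℤ W := Module.Finite.span_of_finite ℤ (Set.finite_range a)
  have : Module.Free ℤ W := inferInstance
  let B := Module.finBasis ℤ W
  set c : Fin (Module.finrank ℤ W) → ℂ := fun l => (B l : ℂ) with hcdef
  have haW : ∀ i, a i ∈ W := fun i => Submodule.subset_span ⟨i, rfl⟩
  set e : Fin n → Fin (Module.finrank ℤ W) → ℤ := fun i l => B.repr ⟨a i, haW i⟩ l
  have hae : ∀ i, a i = ∑ l, e i l • c l := by
    intro i
    have h : ((∑ l, e i l • B l : W) : ℂ) = a i := congrArg Subtype.val (B.sum_repr ⟨a i, haW i⟩)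
    rw [← h, AddSubmonoidClass.coe_finsetSum]
    rfl
  have hc : LinearIndependent ℤ c :=
    B.linearIndependent.map' W.subtype (Submodule.ker_subtype W)
  have hexp : ∀ i, exp (a i) = ∏ l, exp (c l) ^ e i l := by
    intro i
    rw [hae i, exp_sum]
    refine Finset.prod_congr rfl fun l _ => ?_
    rw [zsmul_eq_mul, exp_int_mul]
  have hbalg : ∀ x ∈ Set.range (fun i => exp (a i)),
      IsAlgebraic (Algebra.adjoin k (Set.range fun l => exp (c l))) x := by
    rintro _ ⟨i, rfl⟩
    have hE : ∀ l, IsAlgebraic (Algebra.adjoin k (Set.range fun l => exp (c l))) (exp (c l)) :=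
      fun l => isAlgebraic_algebraMap (⟨exp (c l), Algebra.subset_adjoin ⟨l, rfl⟩⟩ :
        Algebra.adjoin k (Set.range fun l => exp (c l)))
    simp only [hexp]
    refine Finset.prod_induction _ (IsAlgebraic _) (fun _ _ => IsAlgebraic.mul) isAlgebraic_one
      fun l _ => ?_
    obtain ⟨p, hp | hp⟩ := Int.eq_nat_or_neg (e i l)
    · rw [hp, zpow_natCast]
      exact (hE l).pow p
    · rw [hp, zpow_neg, zpow_natCast]
      exact ((hE l).pow p).inv
  have hcalg : ∀ l, IsAlgebraic (Algebra.adjoin k (Set.range fun l => exp (c l))) (c l) := by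
    intro l
    refine IsAlgebraic.adjoin_of_forall_isAlgebraic (fun x hx => hbalg x hx.1) ?_
    exact isAlgebraic_adjoin_of_mem_span_int (by rintro _ ⟨i, rfl⟩; exact halg i) (B l).2
  have hE := (hSC.algebraicIndependent_exp (k := k) hc hcalg).1
  simp only [hexp] at hQ0
  obtain ⟨κ, hκ, κ', hκ', hne, heq⟩ := hE.exists_ne_of_aeval_prod_zpow_eq_zero e hQ hQ0
  have hbd : ∀ κ ∈ Q.support, ∀ i, κ i ≤ D := fun κ hκ i => by
    refine le_trans ?_ ((MvPolynomial.le_totalDegree hκ).trans hQD)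
    by_cases h : i ∈ κ.support
    · exact Finset.single_le_sum (f := κ) (fun _ _ => Nat.zero_le _) h
    · simp [Finsupp.notMem_support_iff.1 h]
  refine hsmall (fun i => κ i - κ' i) ?_ ?_ ?_
  · intro h
    refine hne (Finsupp.ext fun i => ?_)
    have := congrFun h i
    simp only [Pi.zero_apply] at this
    omega
  · intro i
    have h1 := hbd κ hκ i
    have h2 := hbd κ' hκ' i
    rw [abs_le]
    constructor <;> omega
  · have h3 : ∀ κ : Fin n →₀ ℕ,
        ∑ i, (κ i : ℤ) • a i = ∑ l, (∑ i, (κ i : ℤ) * e i l) • c l := by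
      intro κ
      simp_rw [Finset.sum_smul, mul_smul]
      rw [Finset.sum_comm]
      refine Finset.sum_congr rfl fun i _ => ?_
      rw [← Finset.smul_sum, ← hae]
    simp_rw [sub_smul]
    rw [Finset.sum_sub_distrib, h3, h3]
    simp_rw [heq, sub_self]

theorem SchanuelConjecture.exists_algHom_apply_eq_exp (hSC : SchanuelConjecture) {k R : Type*}
    [Field k] [Algebra k ℂ] [Algebra ℚ k] [Algebra.IsAlgebraic ℚ k] [CommRing R] [IsDomain R]
    [Algebra k R] [Algebra.FiniteType k R] {n : ℕ} {x y : Fin n → R}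
    (hx : IsTranscendenceBasis k x) (hy : IsTranscendenceBasis k y) :
    ∃ φ : R →ₐ[k] ℂ, (∀ i, φ (y i) = exp (φ (x i))) ∧
      TrdegEq ℚ (Set.range (fun i => φ (x i)) ∪ Set.range fun i => exp (φ (x i))) n := by
  have : CharZero k := algebraRat.charZero k
  have hxk : LinearIndependent k x := hx.1.linearIndependent
  have hxZ : LinearIndependent ℤ x := by
    refine hxk.restrict_scalars fun p q hpq => ?_
    simpa using hpq
  choose g hg0 hg using fun j => exists_forall_algHom_isAlgebraic (B := ℂ) hy (x j)
  obtain ⟨g', hg'0, D, hg'⟩ := exists_forall_algHom_exists_totalDegree_le (B := ℂ) hy hxZ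
  classical
  set box := (Fintype.piFinset fun _ : Fin n => Finset.Icc (-(D : ℤ)) D).erase 0 with hbox
  have hbox0 : ∏ μ ∈ box, ∑ i, μ i • x i ≠ 0 := by
    refine Finset.prod_ne_zero_iff.2 fun μ hμ h => (Finset.mem_erase.1 hμ).1 ?_
    exact funext (Fintype.linearIndependent_iff.1 hxZ μ h)
  obtain ⟨φ, hφ, hφy⟩ := _root_.exists_algHom_apply_eq_exp hx (fun i => hy.1.ne_zero i)
    (mul_ne_zero (mul_ne_zero (Finset.prod_ne_zero_iff.2 fun j _ => hg0 j) hg'0) hbox0)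
  rw [map_mul, map_mul, map_prod, map_prod] at hφ
  have hφ1 := left_ne_zero_of_mul (left_ne_zero_of_mul hφ)
  have hφ2 := right_ne_zero_of_mul (left_ne_zero_of_mul hφ)
  have hφ3 := right_ne_zero_of_mul hφ
  rw [Finset.prod_ne_zero_iff] at hφ1 hφ3
  have halg : ∀ j, IsAlgebraic (Algebra.adjoin k (Set.range fun i => exp (φ (x i)))) (φ (x j)) := by
    intro j
    have h := hg j φ (hφ1 j (Finset.mem_univ j))
    rwa [funext hφy] at h
  refine ⟨φ, hφy, ((hSC.algebraicIndependent_exp (k := k) ?_ halg).2)⟩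
  refine hSC.linearIndependent (k := k) (D := D) halg (fun m hm h => ?_) fun μ hμ0 hμ => ?_
  · simpa only [hφy] using hg' φ hφ2 m hm h
  · have h := hφ3 μ (Finset.mem_erase.2 ⟨hμ0, Fintype.mem_piFinset.2 fun i =>
      Finset.mem_Icc.2 (abs_le.1 (hμ i))⟩)
    simpa using h

/-- The Krull dimension of a finitely generated domain over a field is at least the number of
elements in any algebraically independent family. -/
theorem AlgebraicIndependent.card_le_ringKrullDim {k R ι : Type} [Field k] [CommRing R]
    [IsDomain R] [Algebra k R] [Algebra.FiniteType k R] [Fintype ι] {f : ι → R}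
    (hf : AlgebraicIndependent k f) : (Fintype.card ι : WithBot ℕ∞) ≤ ringKrullDim R := by
  obtain ⟨s, g, hginj, hgint⟩ := exists_integral_inj_algHom_of_fg k R
  algebraize [g.toRingHom]
  have : IsScalarTower k (MvPolynomial (Fin s) k) R :=
    .of_algebraMap_eq fun r => (g.commutes r).symm
  have : Algebra.IsIntegral (MvPolynomial (Fin s) k) R := ⟨hgint⟩
  have hinj : Function.Injective (algebraMap (MvPolynomial (Fin s) k) R) := hginj
  have : FaithfulSMul (MvPolynomial (Fin s) k) R := (faithfulSMul_iff_algebraMap_injective _ _).2 hinj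
  have hbasis : IsTranscendenceBasis k
      (algebraMap (MvPolynomial (Fin s) k) R ∘ (X : Fin s → MvPolynomial (Fin s) k)) :=
    (IsTranscendenceBasis.mvPolynomial (Fin s) k).algebraMap_comp
  have hcard : Fintype.card ι ≤ s := by
    have h := hf.cardinalMk_le_trdeg
    rw [← hbasis.cardinalMk_eq_trdeg] at h
    simpa using h
  have hdim : ringKrullDim (MvPolynomial (Fin s) k) = s := by simp
  obtain ⟨l, hl⟩ := Order.le_krullDim_iff.1 hdim.ge
  obtain ⟨P, hP, hPl⟩ := Ideal.exists_ideal_over_prime_of_isIntegral_of_isDomain (S := R)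
    l.head.asIdeal (by rw [(RingHom.injective_iff_ker_eq_bot _).1 hinj]; exact bot_le)
  have : P.LiesOver l.head.asIdeal := ⟨hPl.symm⟩
  obtain ⟨L, hL, -, -⟩ := Ideal.exists_ltSeries_of_hasGoingUp l P
  refine le_trans ?_ (Order.le_krullDim_iff.2 ⟨L, hL.trans hl⟩)
  exact_mod_cast hcard

theorem isZClosed_setOf_aeval_eq_zero {σ : Type} {k : Type*} [Field k] [Algebra k ℂ]
    (f : MvPolynomial σ k) : IsZClosed {x : σ → ℂ | aeval x f = 0} :=
  ⟨{map (algebraMap k ℂ) f}, by ext x; simp [zeroSet, aeval_def, eval_map]⟩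

theorem IsZIrreducible.isPrime_vanishingIdeal {σ : Type} {V : Set (σ → ℂ)}
    (hV : IsZIrreducible V) (k : Type*) [Field k] [Algebra k ℂ] :
    (vanishingIdeal k V).IsPrime := by
  refine ⟨fun h => ?_, fun {f g} hfg => ?_⟩
  · obtain ⟨x, hx⟩ := hV.1
    have h1 : (1 : MvPolynomial σ k) ∈ vanishingIdeal k V := h ▸ Submodule.mem_top
    simpa using h1 x hx
  · refine hV.2 _ _ (isZClosed_setOf_aeval_eq_zero f) (isZClosed_setOf_aeval_eq_zero g)
      fun x hx => ?_
    have h := hfg x hx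
    rw [map_mul, mul_eq_zero] at h
    exact h

theorem isZIrreducible_zeroLocus {σ : Type} [Finite σ] (P : Ideal (MvPolynomial σ ℂ))
    [hP : P.IsPrime] : IsZIrreducible (zeroLocus ℂ P) := by
  have hI : vanishingIdeal ℂ (zeroLocus ℂ P) = P := IsPrime.vanishingIdeal_zeroLocus P
  refine ⟨?_, ?_⟩
  · by_contra h
    rw [Set.not_nonempty_iff_eq_empty] at h
    rw [h, vanishingIdeal_empty] at hI
    exact hP.ne_top hI.symm
  · rintro _ _ ⟨T₁, rfl⟩ ⟨T₂, rfl⟩ h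
    by_contra! hcon
    obtain ⟨x, hx, hx1⟩ := Set.not_subset.1 hcon.1
    obtain ⟨y, hy, hy1⟩ := Set.not_subset.1 hcon.2
    simp only [zeroSet, Set.mem_ofPred_eq, not_forall] at hx1 hy1
    obtain ⟨p, hp, hpx⟩ := hx1
    obtain ⟨q, hq, hqy⟩ := hy1
    have hpq : p * q ∈ P := by
      rw [← hI]
      intro z hz
      rw [map_mul]
      rcases h hz with h1 | h1
      · exact mul_eq_zero_of_left (h1 p hp) _
      · exact mul_eq_zero_of_right _ (h1 q hq)
    rcases hP.mem_or_mem hpq with h1 | h1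
    · exact hpx (hx p h1)
    · exact hqy (hy q h1)

theorem ringKrullDim_quotient_vanishingIdeal_le_zdim {σ : Type} [Finite σ] (V : Set (σ → ℂ)) :
    ringKrullDim (MvPolynomial σ ℂ ⧸ vanishingIdeal ℂ V) ≤ zdim V := by
  set I := vanishingIdeal ℂ V
  have hcomap : ∀ p : PrimeSpectrum (MvPolynomial σ ℂ ⧸ I),
      I ≤ p.asIdeal.comap (Ideal.Quotient.mk I) := fun p f hf => by
    rw [Ideal.mem_comap, Ideal.Quotient.eq_zero_iff_mem.2 hf]
    exact p.asIdeal.zero_mem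
  rw [ringKrullDim, ← Order.krullDim_orderDual]
  refine Order.krullDim_le_of_strictMono (fun p =>
    ⟨zeroLocus ℂ ((OrderDual.ofDual p).asIdeal.comap (Ideal.Quotient.mk I)), ⟨_, rfl⟩,
      isZIrreducible_zeroLocus _, ?_⟩) ?_
  · rintro x hx _ ⟨⟨T, rfl⟩, hT⟩ f hf
    exact hx f (hcomap _ fun v hv => hT hv f hf)
  · intro p q hpq
    have h1 : (OrderDual.ofDual q).asIdeal < (OrderDual.ofDual p).asIdeal := hpq
    have h2 := Ideal.comap_mono (f := Ideal.Quotient.mk I) h1.le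
    refine lt_of_le_of_ne (zeroLocus_anti_mono h2) fun h => h1.ne ?_
    have h3 := congrArg (fun s => vanishingIdeal ℂ s.1) h
    simp only [IsPrime.vanishingIdeal_zeroLocus] at h3
    exact (Ideal.comap_injective_of_surjective _ Ideal.Quotient.mk_surjective h3).symm

/-- On an irreducible set of dimension `n`, any `n + 1` polynomials satisfy an algebraic
relation. -/
theorem IsZIrreducible.exists_ne_zero_forall_aeval_eq_zero {σ ι : Type} [Finite σ] [Fintype ι]
    {V : Set (σ → ℂ)} (hV : IsZIrreducible V) {n : ℕ} (hn : zdim V = n)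
    (hι : n < Fintype.card ι) (f : ι → MvPolynomial σ ℂ) :
    ∃ F : MvPolynomial ι ℂ, F ≠ 0 ∧ ∀ x ∈ V, eval (fun i => eval x (f i)) F = 0 := by
  have := hV.isPrime_vanishingIdeal ℂ
  by_contra! hcon
  have hind : AlgebraicIndependent ℂ fun i => Ideal.Quotient.mkₐ ℂ (vanishingIdeal ℂ V) (f i) := by
    refine algebraicIndependent_iff.2 fun F hF => ?_
    by_contra hF0
    obtain ⟨x, hx, hxF⟩ := hcon F hF0
    apply hxF
    rw [← comp_aeval_apply, Ideal.Quotient.mkₐ_eq_mk, Ideal.Quotient.eq_zero_iff_mem] at hF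
    have h := hF x hx
    rw [comp_aeval_apply] at h
    simpa [aeval_eq_eval] using h
  have h := hind.card_le_ringKrullDim.trans (ringKrullDim_quotient_vanishingIdeal_le_zdim V)
  rw [hn] at h
  exact absurd h (not_le.2 (by exact_mod_cast hι))

/-- Applying a linear functional to the coefficients of a polynomial. -/
noncomputable def MvPolynomial.mapCoeff {σ k K : Type*} [Field k] [Field K] [Algebra k K]
    (l : K →ₗ[k] k) (f : MvPolynomial σ K) : MvPolynomial σ k :=
  ∑ m ∈ f.support, monomial m (l (coeff m f))

section mapCoeff

variable {σ k K : Type*} [Field k] [Field K] [Algebra k K] (l : K →ₗ[k] k)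

theorem MvPolynomial.coeff_mapCoeff (f : MvPolynomial σ K) (m : σ →₀ ℕ) :
    coeff m (mapCoeff l f) = l (coeff m f) := by
  classical
  rw [mapCoeff, coeff_sum]
  simp only [coeff_monomial, Finset.sum_ite_eq']
  split_ifs with h
  · rfl
  · rw [notMem_support_iff.1 h, map_zero]

theorem MvPolynomial.mapCoeff_add (f g : MvPolynomial σ K) :
    mapCoeff l (f + g) = mapCoeff l f + mapCoeff l g := by
  ext m
  simp [coeff_mapCoeff]

theorem MvPolynomial.mapCoeff_zero : mapCoeff l (0 : MvPolynomial σ K) = 0 := by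
  simp [mapCoeff]

theorem MvPolynomial.mapCoeff_map_mul (p : MvPolynomial σ k) (q : MvPolynomial σ K) :
    mapCoeff l (map (algebraMap k K) p * q) = p * mapCoeff l q := by
  classical
  ext m
  rw [coeff_mapCoeff, coeff_mul, coeff_mul, map_sum]
  refine Finset.sum_congr rfl fun a _ => ?_
  rw [coeff_map, coeff_mapCoeff, ← Algebra.smul_def, map_smul, smul_eq_mul]

theorem MvPolynomial.mapCoeff_C (a : K) :
    mapCoeff l (C a : MvPolynomial σ K) = C (l a) := by
  classical
  ext m
  rw [coeff_mapCoeff, coeff_C, coeff_C]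
  split_ifs <;> simp

theorem MvPolynomial.mapCoeff_aeval {ι : Type*} [Finite ι] (f : ι → MvPolynomial σ k)
    (F : MvPolynomial ι K) :
    mapCoeff l (aeval (fun i => map (algebraMap k K) (f i)) F) = aeval f (mapCoeff l F) := by
  have := Fintype.ofFinite ι
  induction F using MvPolynomial.induction_on' with
  | monomial m a =>
    have h1 : mapCoeff l (monomial m a) = monomial m (l a) := by
      classical
      ext m'
      rw [coeff_mapCoeff, coeff_monomial, coeff_monomial]
      split_ifs <;> simp
    rw [h1, aeval_monomial, aeval_monomial, mul_comm, mul_comm (algebraMap k _ _)]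
    rw [Finsupp.prod_fintype _ _ fun _ => pow_zero _, Finsupp.prod_fintype _ _ fun _ => pow_zero _]
    simp only [← map_pow]
    rw [← map_prod, mapCoeff_map_mul, algebraMap_eq, algebraMap_eq, mapCoeff_C]
  | add p q hp hq => rw [map_add, mapCoeff_add, mapCoeff_add, map_add, hp, hq]

theorem MvPolynomial.mapCoeff_mem {J : Ideal (MvPolynomial σ k)} {f : MvPolynomial σ K}
    (hf : f ∈ J.map (map (algebraMap k K))) : mapCoeff l f ∈ J := by
  suffices h : ∀ a, mapCoeff l (a * f) ∈ J by simpa using h 1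
  induction hf using Submodule.span_induction with
  | mem x hx =>
    obtain ⟨p, hp, rfl⟩ := hx
    intro a
    rw [mul_comm, mapCoeff_map_mul]
    exact J.mul_mem_right _ hp
  | zero => intro a; rw [mul_zero, mapCoeff_zero]; exact J.zero_mem
  | add x y _ _ hx hy => intro a; rw [mul_add, mapCoeff_add]; exact J.add_mem (hx a) (hy a)
  | smul b x _ hx => intro a; rw [smul_eq_mul, ← mul_assoc]; exact hx (a * b)

end mapCoeff

/-- Polynomials over `k` which are algebraically dependent over `K` on an open subset of a
variety defined over `k` are algebraically dependent over `k` on that set. -/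
theorem exists_ne_zero_aeval_mem_vanishingIdeal {σ ι k K : Type*} [Finite σ] [Finite ι] [Field k]
    [Field K] [Algebra k K] [IsAlgClosed K] (J : Ideal (MvPolynomial σ k)) (h : MvPolynomial σ k)
    (f : ι → MvPolynomial σ k) {F : MvPolynomial ι K} (hF : F ≠ 0)
    (hFV : ∀ v ∈ zeroLocus K J, aeval v h ≠ 0 → eval (fun i => aeval v (f i)) F = 0) :
    ∃ G : MvPolynomial ι k, G ≠ 0 ∧
      aeval f G ∈ vanishingIdeal k (zeroLocus K J ∩ {v | aeval v h ≠ 0}) := by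
  set f' : ι → MvPolynomial σ K := fun i => map (algebraMap k K) (f i) with hf'
  set h' : MvPolynomial σ K := map (algebraMap k K) h with hh'
  have hmem : h' * aeval f' F ∈ (J.map (map (algebraMap k K))).radical := by
    rw [← vanishingIdeal_zeroLocus_eq_radical (K := K)]
    intro v hv
    have hvJ : v ∈ zeroLocus K J := fun p hp => by
      have := hv _ (Ideal.mem_map_of_mem _ hp)
      rwa [aeval_map_algebraMap] at this
    rw [map_mul, hh', aeval_map_algebraMap]
    by_cases h0 : aeval v h = 0
    · rw [h0, zero_mul]
    · have h1 := hFV v hvJ h0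
      rw [comp_aeval_apply]
      simp only [hf', aeval_map_algebraMap]
      rw [aeval_eq_eval, h1, mul_zero]
  obtain ⟨r, hr⟩ := hmem
  obtain ⟨m, hm⟩ := MvPolynomial.ne_zero_iff.1 (pow_ne_zero r hF)
  obtain ⟨l, hl⟩ : ∃ l : K →ₗ[k] k, l (coeff m (F ^ r)) ≠ 0 := by
    by_contra! hcon
    exact hm ((Module.forall_dual_apply_eq_zero_iff k _).1 hcon)
  refine ⟨mapCoeff l (F ^ r), fun h0 => hl ?_, fun v hv => ?_⟩
  · rw [← coeff_mapCoeff, h0, coeff_zero]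
  · have h2 := mapCoeff_mem l hr
    rw [mul_pow, hh', ← map_pow, mapCoeff_map_mul, ← map_pow, mapCoeff_aeval] at h2
    have h3 := hv.1 _ h2
    rw [map_mul, map_pow] at h3
    exact (mul_eq_zero.1 h3).resolve_left (pow_ne_zero r hv.2)

theorem IsZDense.algebraicIndependent_mk_X {σ ι : Type} {k : Type*} [Field k] [Algebra k ℂ]
    {V : Set (σ → ℂ)} {e : ι → σ} (h : IsZDense {x : ι → ℂ | ∃ v ∈ V, x = fun i => v (e i)}) :
    AlgebraicIndependent k
      fun i => Ideal.Quotient.mkₐ k (vanishingIdeal k V) (X (e i)) := by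
  rw [algebraicIndependent_iff]
  intro p hp
  rw [← comp_aeval_apply, Ideal.Quotient.mkₐ_eq_mk, Ideal.Quotient.eq_zero_iff_mem] at hp
  refine map_injective _ (algebraMap k ℂ).injective ?_
  rw [map_zero]
  refine h _ ?_
  rintro _ ⟨v, hv, rfl⟩
  have h1 := hp v hv
  rw [comp_aeval_apply] at h1
  simpa [eval_map, aeval_def] using h1

theorem AlgebraicIndependent.isTranscendenceBasis_of_forall_option {k R ι : Type*} [Field k]
    [CommRing R] [IsDomain R] [Algebra k R] {x : ι → R} (hx : AlgebraicIndependent k x)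
    (h : ∀ f : Option ι → R, ¬ AlgebraicIndependent k f) : IsTranscendenceBasis k x := by
  rw [hx.isTranscendenceBasis_iff_isAlgebraic]
  refine ⟨fun a => ?_⟩
  by_contra ha
  exact h _ ((hx.option_iff_transcendental a).2 ha)

theorem not_algebraicIndependent_quotient_vanishingIdeal {σ ι : Type} {k : Type*} [Finite σ]
    [Fintype ι] [Field k] [Algebra k ℂ] {V : Set (σ → ℂ)} (hV : IsZIrreducible V) {n : ℕ}
    (hn : zdim V = n) (hι : n < Fintype.card ι) {J : Ideal (MvPolynomial σ k)}
    {h : MvPolynomial σ k} (hVJ : V = zeroLocus ℂ J ∩ {v | aeval v h ≠ 0})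
    (f : ι → MvPolynomial σ k ⧸ vanishingIdeal k V) : ¬ AlgebraicIndependent k f := by
  choose g hg using fun i => Ideal.Quotient.mkₐ_surjective k (vanishingIdeal k V) (f i)
  obtain ⟨F, hF, hFV⟩ :=
    hV.exists_ne_zero_forall_aeval_eq_zero hn hι fun i => map (algebraMap k ℂ) (g i)
  obtain ⟨G, hG, hGV⟩ := exists_ne_zero_aeval_mem_vanishingIdeal J h g hF fun v hv hvh => by
    simpa [eval_map, aeval_def] using hFV v (hVJ ▸ ⟨hv, hvh⟩)
  rw [← hVJ] at hGV
  intro hind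
  refine hG ((algebraicIndependent_iff.1 hind) G ?_)
  rw [← funext hg, ← comp_aeval_apply, Ideal.Quotient.mkₐ_eq_mk, Ideal.Quotient.eq_zero_iff_mem]
  exact hGV

theorem zeroSet_eq_zeroLocus_span {σ : Type} {k : Type*} [Field k] [Algebra k ℂ]
    {T : Set (MvPolynomial σ ℂ)} (hT : ∀ p ∈ T, ∀ m, coeff m p ∈ (algebraMap k ℂ).range) :
    zeroSet T = zeroLocus ℂ (Ideal.span (map (algebraMap k ℂ) ⁻¹' T)) := by
  rw [zeroLocus_span]
  ext v
  refine ⟨fun hv p hp => ?_, fun hv p hp => ?_⟩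
  · rw [← hv _ hp, eval_map, aeval_def]
  · obtain ⟨q, rfl⟩ : p ∈ Set.range (map (algebraMap k ℂ)) := by
      rw [mem_range_map_iff_coeffs_subset]
      intro c hc
      obtain ⟨m, _, rfl⟩ := mem_coeffs_iff.1 hc
      exact hT p hp m
    rw [eval_map, ← aeval_def]
    exact hv q hp

/-- Assuming Schanuel's Conjecture, an irreducible variety
`V ⊆ ℂ^n × (ℂ*)^n` defined over the algebraic closure of `ℚ`, of dimension `n`,
with both projections dominant, contains a generic point of the form `(ā, e^ā)`. -/
theorem strong_exponential_closure_generic_point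
    (hSC : SchanuelConjecture) (n : ℕ) (hn : 1 ≤ n)
    (V : Set (Fin n ⊕ Fin n → ℂ))
    (T : Set (MvPolynomial (Fin n ⊕ Fin n) ℂ))
    (hTalg : ∀ p ∈ T, ∀ m, IsAlgebraic ℚ (MvPolynomial.coeff m p))
    (hV : V = zeroSet T ∩ {v | ∀ i, v (Sum.inr i) ≠ 0})
    (hVirr : IsZIrreducible V)
    (hVdim : zdim V = (n : WithBot ℕ∞))
    (hdom₁ : IsZDense {x : Fin n → ℂ | ∃ v ∈ V, x = fun i => v (Sum.inl i)})
    (hdom₂ : IsZDense {y : Fin n → ℂ | ∃ v ∈ V, y = fun i => v (Sum.inr i)}) :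
    ∃ a : Fin n → ℂ, Sum.elim a (fun i => exp (a i)) ∈ V ∧
      TrdegEq ℚ (Set.range a ∪ Set.range fun i => exp (a i)) n := by
  set k := algebraicClosure ℚ ℂ
  have : Algebra.IsAlgebraic ℚ k := algebraicClosure.isAlgebraic ℚ ℂ
  have hT : ∀ p ∈ T, ∀ m, coeff m p ∈ (algebraMap k ℂ).range := fun p hp m =>
    ⟨⟨_, mem_algebraicClosure_iff.2 (hTalg p hp m)⟩, rfl⟩
  have hVJ : V = zeroLocus ℂ (Ideal.span (map (algebraMap k ℂ) ⁻¹' T)) ∩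
      {v | aeval v (∏ i, X (Sum.inr i) : MvPolynomial (Fin n ⊕ Fin n) k) ≠ 0} := by
    rw [hV, zeroSet_eq_zeroLocus_span hT]
    congr 1
    ext v
    simp [map_prod, Finset.prod_ne_zero_iff]
  have := hVirr.isPrime_vanishingIdeal k
  have hcard : n < Fintype.card (Option (Fin n)) := by simp
  have hdep := not_algebraicIndependent_quotient_vanishingIdeal hVirr hVdim hcard hVJ
  obtain ⟨φ, hφ, htr⟩ := hSC.exists_algHom_apply_eq_exp
    (hdom₁.algebraicIndependent_mk_X.isTranscendenceBasis_of_forall_option hdep)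
    (hdom₂.algebraicIndependent_mk_X.isTranscendenceBasis_of_forall_option hdep)
  refine ⟨_, ?_, htr⟩
  set v := fun s => φ (Ideal.Quotient.mkₐ k (vanishingIdeal k V) (X s)) with hv
  have hv' : Sum.elim (fun i => v (Sum.inl i)) (fun i => exp (v (Sum.inl i))) = v := by
    ext (i | i)
    · rfl
    · exact (hφ i).symm
  have hvan : ∀ p ∈ vanishingIdeal k V, aeval v p = 0 := fun p hp => by
    rw [hv, ← comp_aeval_apply, ← comp_aeval_apply, aeval_X_left_apply, Ideal.Quotient.mkₐ_eq_mk,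
      Ideal.Quotient.eq_zero_iff_mem.2 hp, map_zero]
  change Sum.elim (fun i => v (Sum.inl i)) (fun i => exp (v (Sum.inl i))) ∈ V
  rw [hv', hV, zeroSet_eq_zeroLocus_span hT]
  refine ⟨fun p hp => hvan p ?_, fun i => ?_⟩
  · intro w hw
    rw [hVJ] at hw
    exact hw.1 p hp
  · exact (hφ i).trans_ne (exp_ne_zero _)
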